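/- arXiv:1009.3990 — 2 statements merged into one kernel-verified Lean document; each statement's English description precedes it below -/
import Mathlib

section
/- If p is a prime number with p ≡ 1 (mod 8), then the class number of the field ℚ(p^{1/4}) (the number field obtained by adjoining to ℚ a root of x⁴ − p) is even. -/
set_option maxHeartbeats 1000000
set_option synthInstance.maxHeartbeats 400000

open NumberField

open Polynomial in
/-- Over a domain, perturbing a scalar matrix by a nilpotent matrix does not change
its determinant. -/
theorem Matrix.det_scalar_add_of_isNilpotent {R n : Type*} [CommRing R] [IsDomain R] [Fintype n]
    [DecidableEq n] {N : Matrix n n R} (hN : IsNilpotent N) (a : R) :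
    (Matrix.scalar n a + N).det = a ^ Fintype.card n := by
  have h := (Matrix.isNilpotent_charpoly_sub_pow_of_isNilpotent hN.neg).eq_zero
  rw [← sub_neg_eq_add, ← Matrix.eval_charpoly, sub_eq_zero.mp h]
  simp

/-- If `x` is congruent to the integer `a` up to an element that is nilpotent modulo `p`, then the
norm of `x` is congruent modulo `p` to the norm of `a`. -/
theorem Algebra.intCast_norm_add_eq_pow_finrank {S : Type*} [CommRing S] [Module.Free ℤ S]
    [Module.Finite ℤ S] {p : ℕ} [Fact p.Prime] {t : S} {k : ℕ} (ht : (p : S) ∣ t ^ k) (a : ℤ) :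
    ((Algebra.norm ℤ ((a : S) + t) : ℤ) : ZMod p) = (a : ZMod p) ^ Module.finrank ℤ S := by
  classical
  let b := Module.Free.chooseBasis ℤ S
  let f : S →+* Matrix _ _ (ZMod p) :=
    (Int.castRingHom (ZMod p)).mapMatrix.comp (Algebra.leftMulMatrix b).toRingHom
  have hN : IsNilpotent (f t) := by
    obtain ⟨c, hc⟩ := ht
    refine ⟨k, ?_⟩
    rw [← map_pow, hc, map_mul, map_natCast, ← Matrix.diagonal_natCast]
    simp
  have key := Matrix.det_scalar_add_of_isNilpotent hN (a : ZMod p)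
  rw [Module.finrank_eq_card_basis b, ← key, Algebra.norm_eq_matrix_det b]
  change Int.castRingHom (ZMod p) _ = _
  rw [RingHom.map_det]
  change (f (a + t)).det = _
  rw [map_add, map_intCast]
  congr 2

/-- For a prime `p ≡ 1 (mod 4)` there is an odd prime `q` modulo which `p` is a fourth power,
and which is a quadratic but not a quartic residue modulo `p`. -/
theorem Nat.Prime.exists_prime_quartic_residue {p : ℕ} (hp : p.Prime) (hp4 : p % 4 = 1) :
    ∃ q : ℕ, q.Prime ∧ q ≠ 2 ∧ q ≠ p ∧ (q : ZMod p) ^ ((p - 1) / 4) = -1 ∧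
      ∃ c : ZMod q, c ^ 4 = p := by
  have := Fact.mk hp
  have hp2 : p ≠ 2 := by rintro rfl; omega
  obtain ⟨u, hu⟩ := FiniteField.exists_nonsquare (F := ZMod p) (by rwa [ZMod.ringChar_zmod_n])
  have hu0 : u ≠ 0 := by rintro rfl; exact hu (IsSquare.zero)
  have hcop : Nat.Coprime p 4 :=
    (Nat.coprime_primes hp Nat.prime_two).mpr hp2 |>.pow_right 2
  have hval : ((u ^ 2).val : ZMod p) = u ^ 2 := by simp
  obtain ⟨n, hn1, hn2⟩ := Nat.chineseRemainder hcop (u ^ 2).val 3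
  have hnp : (n : ZMod p) = u ^ 2 := by
    rw [← hval]; exact (ZMod.natCast_eq_natCast_iff _ _ _).mpr hn1
  have hncop : n.Coprime (p * 4) := by
    refine Nat.Coprime.mul_right ?_ ?_
    · rw [Nat.coprime_comm, hp.coprime_iff_not_dvd, ← ZMod.natCast_eq_zero_iff, hnp]
      exact pow_ne_zero 2 hu0
    · have : n % 4 = 3 := hn2
      rw [Nat.Coprime, Nat.gcd_comm, Nat.gcd_rec, this]
      rfl
  obtain ⟨q, -, hq, hqn⟩ := Nat.forall_exists_prime_gt_and_modEq 0
    (mul_ne_zero hp.ne_zero four_ne_zero) hncop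
  have := Fact.mk hq
  have hq4 : q % 4 = 3 := (hqn.of_mul_left p).trans hn2
  have hqp : (q : ZMod p) = u ^ 2 := by
    rw [← hnp]; exact (ZMod.natCast_eq_natCast_iff _ _ _).mpr (hqn.of_mul_right 4)
  have hq2 : q ≠ 2 := by rintro rfl; omega
  refine ⟨q, hq, hq2, by rintro rfl; omega, ?_, ?_⟩
  · rw [hqp, ← pow_mul, show 2 * ((p - 1) / 4) = p / 2 by omega]
    exact (ZMod.pow_div_two_eq_neg_one_or_one p hu0).resolve_left
      fun h => hu ((ZMod.euler_criterion p hu0).mpr h)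
  · obtain ⟨c, hc⟩ := (ZMod.exists_sq_eq_prime_iff_of_mod_four_eq_one hp4 hq2).mp
      ⟨u, by rw [hqp, sq]⟩
    have hneg : ¬ IsSquare (-1 : ZMod q) := by
      rw [ZMod.exists_sq_eq_neg_one_iff]; omega
    have hsq : IsSquare c ∨ IsSquare (-c) := by
      by_contra! h
      simp only [← quadraticChar_neg_one_iff_not_isSquare] at h hneg
      have := h.2
      rw [← neg_one_mul, map_mul, hneg, h.1] at this
      norm_num at this
    rcases hsq with ⟨d, hd⟩ | ⟨d, hd⟩
    · exact ⟨d, by rw [hc, hd]; ring⟩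
    · exact ⟨d, by rw [hc, ← neg_mul_neg, hd]; ring⟩

open Polynomial in
theorem Polynomial.irreducible_X_pow_four_sub_C_prime {p : ℕ} (hp : p.Prime) :
    Irreducible (X ^ 4 - C (p : ℤ)) := by
  have hpZ : Prime (p : ℤ) := Nat.prime_iff_prime_int.mp hp
  have hdeg : (X ^ 4 - C (p : ℤ)).degree = 4 := degree_X_pow_sub_C (by norm_num) _
  have hmonic : (X ^ 4 - C (p : ℤ)).Monic := monic_X_pow_sub_C _ (by norm_num)
  refine irreducible_of_eisenstein_criterion (P := Ideal.span {(p : ℤ)})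
    ((Ideal.span_singleton_prime hpZ.ne_zero).mpr hpZ) ?_ ?_ ?_ ?_ hmonic.isPrimitive
  · rw [hmonic.leadingCoeff, Ideal.mem_span_singleton]
    exact hpZ.not_dvd_one
  · intro n hn
    rw [hdeg] at hn
    have hn' : n ≠ 4 := by rintro rfl; exact lt_irrefl _ hn
    rw [Ideal.mem_span_singleton, coeff_sub, coeff_X_pow, if_neg hn', coeff_C]
    split_ifs <;> simp
  · rw [hdeg]; norm_num
  · rw [Ideal.span_singleton_pow, Ideal.mem_span_singleton]
    intro h
    simp only [coeff_sub, coeff_X_pow, coeff_C_zero, OfNat.zero_ne_ofNat, if_false, zero_sub,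
      dvd_neg] at h
    have := (pow_dvd_pow_iff hpZ.ne_zero hpZ.not_isUnit (n := 2) (m := 1)).mp (by simpa using h)
    omega

namespace NumberField

variable {K : Type*} [Field K] [NumberField K]

/-- If the norm of `θ` is a prime, every algebraic integer is congruent modulo `θ` to a
rational integer. -/
theorem exists_intCast_add_mul_of_absNorm_prime {p : ℕ} (hp : p.Prime) {θ : 𝓞 K}
    (hθ : Ideal.absNorm (Ideal.span {θ}) = p) (x : 𝓞 K) : ∃ (a : ℤ) (y : 𝓞 K), x = a + θ * y := by
  have := Fact.mk hp
  have hcard : Nat.card (𝓞 K ⧸ Ideal.span {θ}) = p := by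
    rw [← hθ, Ideal.absNorm_apply, Submodule.cardQuot_apply]
  have : Finite (𝓞 K ⧸ Ideal.span {θ}) := Nat.finite_of_card_ne_zero (hcard ▸ hp.ne_zero)
  have := Fintype.ofFinite (𝓞 K ⧸ Ideal.span {θ})
  let e := ZMod.ringEquivOfPrime _ hp (Nat.card_eq_fintype_card.symm.trans hcard)
  obtain ⟨z, hz⟩ := e.surjective (Ideal.Quotient.mk _ x)
  obtain ⟨a, rfl⟩ := ZMod.intCast_surjective z
  rw [map_intCast, ← map_intCast (Ideal.Quotient.mk (Ideal.span {θ})), eq_comm,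
    Ideal.Quotient.eq, Ideal.mem_span_singleton] at hz
  obtain ⟨y, hy⟩ := hz
  exact ⟨a, y, by rw [← hy]; ring⟩

section PureQuartic

variable {p : ℕ} {θ : 𝓞 K}

open Polynomial in
theorem minpoly_eq_X_pow_four_sub_C (hp : p.Prime) (hθ : θ ^ 4 = p) :
    minpoly ℤ θ = X ^ 4 - C (p : ℤ) := by
  have hint : IsIntegral ℤ θ := Algebra.IsIntegral.isIntegral θ
  exact eq_of_monic_of_associated (minpoly.monic hint) (monic_X_pow_sub_C _ (by norm_num)) <|
    ((minpoly.prime_of_isIntegrallyClosed hint).irreducible).associated_of_dvd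
      (irreducible_X_pow_four_sub_C_prime hp)
      (minpoly.isIntegrallyClosed_dvd hint (by simp [hθ]))

theorem finrank_eq_four_of_pow_four_eq_prime (hp : p.Prime) (hθ : θ ^ 4 = p)
    (hgen : Algebra.adjoin ℚ {(θ : K)} = ⊤) : Module.finrank ℤ (𝓞 K) = 4 := by
  have hint : IsIntegral ℚ (θ : K) := Algebra.IsIntegral.isIntegral _
  rw [RingOfIntegers.rank, (PowerBasis.ofAdjoinEqTop hint hgen).finrank,
    PowerBasis.ofAdjoinEqTop_dim, minpoly.isIntegrallyClosed_eq_field_fractions ℚ K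
      (Algebra.IsIntegral.isIntegral (R := ℤ) θ), minpoly_eq_X_pow_four_sub_C hp hθ,
    (Polynomial.monic_X_pow_sub_C _ (by norm_num)).natDegree_map,
    Polynomial.natDegree_X_pow_sub_C]

theorem absNorm_span_eq_of_pow_four_eq_prime (hp : p.Prime) (hθ : θ ^ 4 = p)
    (hgen : Algebra.adjoin ℚ {(θ : K)} = ⊤) : Ideal.absNorm (Ideal.span {θ}) = p := by
  refine Nat.pow_left_injective (n := 4) (by norm_num) ?_
  change _ ^ 4 = p ^ 4
  rw [← map_pow, Ideal.span_singleton_pow, hθ, Ideal.absNorm_span_singleton,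
    ← map_natCast (algebraMap ℤ (𝓞 K)), Algebra.norm_algebraMap,
    finrank_eq_four_of_pow_four_eq_prime hp hθ hgen, Int.natAbs_pow, Int.natAbs_natCast]

/-- The norm of an algebraic integer of `ℚ(p^{1/4})` is a fourth power modulo `p`. -/
theorem exists_norm_eq_pow_four (hp : p.Prime) (hθ : θ ^ 4 = p)
    (hgen : Algebra.adjoin ℚ {(θ : K)} = ⊤) (x : 𝓞 K) :
    ∃ a : ZMod p, ((Algebra.norm ℤ x : ℤ) : ZMod p) = a ^ 4 := by
  have := Fact.mk hp
  obtain ⟨a, y, rfl⟩ := exists_intCast_add_mul_of_absNorm_prime hp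
    (absNorm_span_eq_of_pow_four_eq_prime hp hθ hgen) x
  refine ⟨a, ?_⟩
  rw [Algebra.intCast_norm_add_eq_pow_finrank (k := 4) (by rw [mul_pow, hθ]; exact ⟨_, rfl⟩),
    finrank_eq_four_of_pow_four_eq_prime hp hθ hgen]

/-- A prime `q` not dividing `2 * p`, modulo which `p` is a fourth power, has a prime of
degree one above it in `ℚ(p^{1/4})`. -/
theorem exists_absNorm_eq_of_pow_four_eq_prime (hp : p.Prime) (hθ : θ ^ 4 = p)
    (hgen : Algebra.adjoin ℚ {(θ : K)} = ⊤) {q : ℕ} (hq : q.Prime) (hq2 : q ≠ 2) (hqp : q ≠ p)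
    {c : ZMod q} (hc : c ^ 4 = p) : ∃ Q : Ideal (𝓞 K), Ideal.absNorm Q = q := by
  have := Fact.mk hq
  have hmin := minpoly_eq_X_pow_four_sub_C hp hθ
  have hexp : ¬ q ∣ RingOfIntegers.exponent θ := by
    have hmem : ((4 * p : ℤ) : 𝓞 K) ∈ conductor ℤ θ := by
      have h1 : Polynomial.aeval θ (Polynomial.derivative (minpoly ℤ θ)) ∈ conductor ℤ θ := by
        refine (Ideal.mul_le_left : _ * differentIdeal ℤ (𝓞 K) ≤ _) ?_
        rw [conductor_mul_differentIdeal ℤ ℚ K θ hgen]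
        exact Ideal.mem_span_singleton_self _
      convert Ideal.mul_mem_left _ θ h1 using 1
      rw [hmin]
      simp only [Polynomial.derivative_sub, Polynomial.derivative_X_pow, Polynomial.derivative_C]
      simp only [Nat.cast_ofNat, Int.cast_mul, Int.cast_ofNat, Int.cast_natCast, ← hθ, map_mul,
        sub_zero, map_pow, Polynomial.aeval_X, map_ofNat]
      ring
    have hdvd : (RingOfIntegers.exponent θ : ℤ) ∣ 4 * p := by
      rw [← Ideal.mem_span_singleton, RingOfIntegers.exponent, Int.ideal_span_absNorm_eq_self]
      simpa [Ideal.under_def] using hmem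
    intro h
    have h4 : q ∣ 2 ^ 2 * p := by
      have := (Int.natCast_dvd_natCast.mpr h).trans hdvd
      exact_mod_cast this
    rcases hq.dvd_mul.mp h4 with h | h
    · exact hq2 ((Nat.prime_dvd_prime_iff_eq hq Nat.prime_two).mp (hq.dvd_of_dvd_pow h))
    · exact hqp ((Nat.prime_dvd_prime_iff_eq hq hp).mp h)
  have hfac : Polynomial.X - Polynomial.C c ∈ RingOfIntegers.monicFactorsMod θ q := by
    rw [Multiset.mem_toFinset, Polynomial.mem_normalizedFactors_iff
      (Polynomial.map_monic_ne_zero (minpoly.monic θ.isIntegral))]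
    refine ⟨Polynomial.irreducible_X_sub_C c, Polynomial.monic_X_sub_C c, ?_⟩
    rw [Polynomial.dvd_iff_isRoot, hmin]
    simp [hc]
  let P := (Ideal.primesOverSpanEquivMonicFactorsMod hexp).symm ⟨_, hfac⟩
  have hdeg := Ideal.inertiaDeg_primesOverSpanEquivMonicFactorsMod_symm_apply' hexp hfac
  have hP : (P : Ideal (𝓞 K)).LiesOver (Ideal.span {(q : ℤ)}) := P.2.2
  have hmax : (P : Ideal (𝓞 K)).IsMaximal := Ideal.primesOver.isMaximal P
  refine ⟨P, ?_⟩
  rw [Ideal.absNorm_eq_pow_inertiaDeg' _ hq]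
  rw [Ideal.inertiaDeg'_algebraMap,
    ← Ideal.inertiaDeg_eq_of_isMaximal (Ideal.span {(q : ℤ)}), hdeg,
    Polynomial.natDegree_X_sub_C, pow_one]

end PureQuartic

end NumberField

/-- **Theorem 1 (Lemmermeyer).** If `p` is a prime with `p ≡ 1 (mod 8)`, then the class number
of `ℚ(p^{1/4})`, i.e. of any number field generated over `ℚ` by an element `α` with `α ^ 4 = p`,
is even. -/
theorem classNumber_even_of_prime_mod_eight_eq_one
    (p : ℕ) (hp : p.Prime) (hp8 : p % 8 = 1)
    (K : Type) [Field K] [NumberField K] (α : K)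
    (hα : α ^ 4 = (p : K)) (hgen : Algebra.adjoin ℚ {α} = ⊤) :
    Even (NumberField.classNumber K) := by
  have := Fact.mk hp
  have hint : IsIntegral ℤ α := .of_pow (n := 4) (by norm_num) (hα ▸ isIntegral_natCast p)
  obtain ⟨θ, rfl⟩ : ∃ θ : 𝓞 K, (θ : K) = α := ⟨⟨α, hint⟩, rfl⟩
  have hθ : θ ^ 4 = p := RingOfIntegers.ext (by simpa using hα)
  obtain ⟨q, hq, hq2, hqp, hquart, c, hc⟩ := hp.exists_prime_quartic_residue (by omega)
  obtain ⟨Q, hQ⟩ := exists_absNorm_eq_of_pow_four_eq_prime hp hθ hgen hq hq2 hqp hc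
  have hQ0 : Q ∈ nonZeroDivisors (Ideal (𝓞 K)) :=
    mem_nonZeroDivisors_of_ne_zero fun h => hq.ne_zero (by rw [← hQ, h]; simp)
  have hprin : (Q ^ NumberField.classNumber K).IsPrincipal := by
    rw [← ClassGroup.mk0_eq_one_iff (pow_mem hQ0 _)]
    have : ClassGroup.mk0 ⟨Q, hQ0⟩ ^ NumberField.classNumber K = 1 := pow_card_eq_one
    rw [← map_pow] at this
    exact this
  obtain ⟨x, hx⟩ := hprin
  have hnorm : (Algebra.norm ℤ x).natAbs = q ^ NumberField.classNumber K := by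
    rw [← Ideal.absNorm_span_singleton, ← hQ, ← map_pow, hx]
  obtain ⟨a, ha⟩ := exists_norm_eq_pow_four hp hθ hgen x
  obtain ⟨m, hm⟩ : ∃ m, p = 8 * m + 1 := ⟨p / 8, by omega⟩
  have hm4 : (p - 1) / 4 = 2 * m := by omega
  have hpow : (q : ZMod p) ^ (NumberField.classNumber K * (2 * m)) = a ^ (p - 1) := by
    have hsq : ((q : ZMod p) ^ NumberField.classNumber K) ^ 2 = (a ^ 4) ^ 2 := by
      rw [← ha]
      have := congrArg (Int.cast (R := ZMod p)) (Int.natAbs_sq (Algebra.norm ℤ x))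
      rw [hnorm] at this
      exact_mod_cast this
    rw [pow_mul, pow_mul, hsq, ← pow_mul, ← pow_mul]
    congr 1
    omega
  have ha0 : a ≠ 0 := by
    rintro rfl
    rw [zero_pow (by have := hp.two_le; omega)] at hpow
    have hq0 : (q : ZMod p) = 0 := eq_zero_of_pow_eq_zero hpow
    rw [ZMod.natCast_eq_zero_iff, Nat.prime_dvd_prime_iff_eq hp hq] at hq0
    exact hqp hq0.symm
  rw [ZMod.pow_card_sub_one_eq_one ha0, mul_comm, pow_mul, ← hm4, hquart] at hpow
  have : Fact (2 < p) := ⟨by have := hp.two_le; omega⟩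
  exact (neg_one_pow_eq_one_iff_even (ZMod.neg_one_ne_one)).mp hpow
end

section
/- Let p be a prime with p ≡ 1 (mod 8) and let F be the unique quartic subfield of ℚ(μ_p). If the compositum F(p^{1/4}) has odd class number, then the class number of ℚ(p^{1/4}) is ≡ 2 (mod 4). -/
set_option maxHeartbeats 1000000
set_option synthInstance.maxHeartbeats 400000

open NumberField IntermediateField

section Involution

variable {A B : Type*} [CommRing A] [CommRing B] [Algebra A B] {τ : B ≃ₐ[A] B}

/-- The contraction of a prime with trivial inertia extends back to the intersection of the prime
and its conjugate. -/
lemma mem_map_comap_of_mem_of_conj_mem [Algebra.IsIntegral A B]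
    (hτ : ∀ x, τ (τ x) = x) (hfix : ∀ x, τ x = x → ∃ a, algebraMap A B a = x)
    {P : Ideal B} (hP : P.IsMaximal) {x₀ : B} (hx₀ : τ x₀ - x₀ ∉ P)
    {y : B} (hy : y ∈ P) (hτy : τ y ∈ P) :
    y ∈ (P.comap (algebraMap A B)).map (algebraMap A B) := by
  set q := P.comap (algebraMap A B) with hq
  have hqm : q.IsMaximal := Ideal.isMaximal_comap_of_isIntegral_of_isMaximal P
  have key : ∀ z, τ z = z → z ∈ P → z ∈ q.map (algebraMap A B) := by
    intro z hz hzP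
    obtain ⟨a, rfl⟩ := hfix z hz
    exact Ideal.mem_map_of_mem _ hzP
  have h1 : y + τ y ∈ q.map (algebraMap A B) :=
    key _ (by rw [map_add, hτ, add_comm]) (add_mem hy hτy)
  have h2 : x₀ * y + τ x₀ * τ y ∈ q.map (algebraMap A B) :=
    key _ (by rw [map_add, map_mul, map_mul, hτ, hτ, add_comm])
      (add_mem (P.mul_mem_left _ hy) (P.mul_mem_left _ hτy))
  have h3 : (τ x₀ - x₀) * y ∈ q.map (algebraMap A B) := by
    have : (τ x₀ - x₀) * y = τ x₀ * (y + τ y) - (x₀ * y + τ x₀ * τ y) := by ring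
    rw [this]
    exact sub_mem (Ideal.mul_mem_left _ _ h1) h2
  obtain ⟨s, hs⟩ := hfix ((τ x₀ - x₀) ^ 2) (by rw [map_pow, map_sub, hτ]; ring)
  have hsq : s ∉ q := by
    intro h
    rw [hq, Ideal.mem_comap, hs] at h
    exact hx₀ (hP.isPrime.mem_of_pow_mem _ h)
  obtain ⟨t, i, hi, hti⟩ := hqm.exists_inv hsq
  have : y = algebraMap A B t * ((τ x₀ - x₀) * ((τ x₀ - x₀) * y)) + y * algebraMap A B i := by
    have := congrArg (algebraMap A B) hti
    rw [map_add, map_mul, hs, map_one] at this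
    linear_combination (-y) * this
  rw [this]
  exact add_mem (Ideal.mul_mem_left _ _ (Ideal.mul_mem_left _ _ h3))
    (Ideal.mul_mem_left _ _ (Ideal.mem_map_of_mem _ hi))

lemma map_conj_eq_self (hτ : ∀ x, τ (τ x) = x) {P : Ideal B} (h : ∀ x, τ x - x ∈ P) :
    P.map τ = P := by
  apply le_antisymm
  · rw [Ideal.map_le_iff_le_comap]
    intro x hx
    simpa using add_mem (h x) hx
  · intro x hx
    rw [← hτ x]
    apply Ideal.mem_map_of_mem
    simpa using add_mem (h x) hx

lemma map_conj_map_conj (hτ : ∀ x, τ (τ x) = x) (I : Ideal B) : (I.map τ).map τ = I := by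
  change Ideal.map (τ : B →+* B) (Ideal.map (τ : B →+* B) I) = I
  rw [Ideal.map_map]
  have : (τ : B →+* B).comp (τ : B →+* B) = RingHom.id B := RingHom.ext hτ
  exact (congrArg (fun f : B →+* B => I.map f) this).trans (Ideal.map_id I)

lemma map_conj_map_algebraMap (J : Ideal A) :
    (J.map (algebraMap A B)).map τ = J.map (algebraMap A B) := by
  change Ideal.map (τ : B →+* B) (Ideal.map (algebraMap A B) J) = _
  rw [Ideal.map_map]
  congr 1
  ext x
  simp

lemma map_conj_ne_bot {I : Ideal B} (hI : I ≠ ⊥) : I.map τ ≠ ⊥ := by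
  rw [Ne, Ideal.map_eq_bot_iff_of_injective τ.injective]
  exact hI

/-- An invariant ideal is a product of extended ideals and of primes with nontrivial inertia. -/
lemma mem_submonoid_of_map_conj_eq [IsDomain A] [IsDedekindDomain B] [Algebra.IsIntegral A B] [FaithfulSMul A B]
    (hτ : ∀ x, τ (τ x) = x) (hfix : ∀ x, τ x = x → ∃ a, algebraMap A B a = x)
    (S : Submonoid (Ideal B)) (hext : ∀ J : Ideal A, J ≠ ⊥ → J.map (algebraMap A B) ∈ S)
    (hram : ∀ P : Ideal B, P.IsPrime → P ≠ ⊥ → (∀ x, τ x - x ∈ P) → P ∈ S)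
    (I : Ideal B) (hI : I ≠ ⊥) (hinv : I.map τ = I) : I ∈ S := by
  induction I using WellFoundedGT.induction with
  | ind I ih =>
  by_cases htop : I = ⊤
  · rw [htop, ← Ideal.one_eq_top]; exact one_mem S
  obtain ⟨P, hP, hIP⟩ := Ideal.exists_le_maximal I htop
  have hPb : P ≠ ⊥ := fun h => hI (le_bot_iff.mp (h ▸ hIP))
  have main : ∀ D : Ideal B, D ∈ S → D ≠ ⊤ → D.map τ = D → I ≤ D → I ∈ S := by
    intro D hDS hDt hDinv hID
    obtain ⟨I', rfl⟩ := Ideal.dvd_iff_le.mpr hID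
    have hD0 : D ≠ ⊥ := by rintro rfl; simp at hI
    have hI'0 : I' ≠ ⊥ := by rintro rfl; simp at hI
    refine S.mul_mem hDS (ih I' (lt_of_le_of_ne Ideal.mul_le_right ?_) hI'0 ?_)
    · intro h
      have : 1 * I' = D * I' := by rw [one_mul]; exact h.symm
      have := mul_right_cancel₀ hI'0 this
      exact hDt (this.symm.trans Ideal.one_eq_top)
    · rw [Ideal.map_mul, hDinv] at hinv
      exact mul_left_cancel₀ hD0 hinv
  by_cases hr : ∀ x, τ x - x ∈ P
  · exact main P (hram P hP.isPrime hPb hr) hP.ne_top (map_conj_eq_self hτ hr) hIP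
  · push Not at hr
    obtain ⟨x₀, hx₀⟩ := hr
    refine main _ (hext (P.comap (algebraMap A B)) ?_) ?_ (map_conj_map_algebraMap _) ?_
    · exact Ideal.IsIntegral.comap_ne_bot A hPb
    · intro h
      exact hP.ne_top (top_le_iff.mp (h ▸ Ideal.map_comap_le))
    · intro y hy
      refine mem_map_comap_of_mem_of_conj_mem hτ hfix hP hx₀ (hIP hy) (hIP ?_)
      rw [← hinv]
      exact Ideal.mem_map_of_mem _ hy

/-- Hilbert's Theorem 90 with denominators cleared. -/
lemma exists_conj_ratio [IsDomain B] (hτ : ∀ x, τ (τ x) = x) (hne : ∃ x, τ x ≠ x) {x y : B} (hy : y ≠ 0)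
    (h : x * τ x = y * τ y) : ∃ g, g ≠ 0 ∧ x * τ g = y * g := by
  have hτ0 : τ y ≠ 0 := by simpa using hy
  have main : ∀ θ : B, y * θ + x * τ θ ≠ 0 → ∃ g, g ≠ 0 ∧ x * τ g = y * g := by
    intro θ hθ
    refine ⟨(y * θ + x * τ θ) * τ y, mul_ne_zero hθ hτ0, ?_⟩
    simp only [map_mul, map_add, hτ]
    linear_combination (y * θ) * h
  by_cases hxy : y * 1 + x * τ 1 = 0
  · obtain ⟨θ, hθ⟩ := hne
    refine main θ fun h0 => ?_
    rw [map_one, mul_one, mul_one] at hxy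
    have : y * (θ - τ θ) = 0 := by linear_combination h0 - τ θ * hxy
    rcases mul_eq_zero.mp this with h | h
    · exact hy h
    · exact hθ (sub_eq_zero.mp h).symm
  · exact main 1 hxy

/-- The product of an ideal with its conjugate is extended from the fixed ring. -/
lemma exists_mul_map_conj_eq_map [IsDomain A] [IsDedekindDomain B] [Algebra.IsIntegral A B] [FaithfulSMul A B]
    (hτ : ∀ x, τ (τ x) = x) (hfix : ∀ x, τ x = x → ∃ a, algebraMap A B a = x)
    (I : Ideal B) (hI : I ≠ ⊥) :
    ∃ J : Ideal A, J ≠ ⊥ ∧ I * I.map τ = J.map (algebraMap A B) := by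
  induction I using WellFoundedGT.induction with
  | ind I ih =>
  by_cases htop : I = ⊤
  · refine ⟨⊤, top_ne_bot, ?_⟩
    rw [htop, Ideal.map_top, Ideal.map_top, Ideal.mul_top]
  obtain ⟨P, hP, hIP⟩ := Ideal.exists_le_maximal I htop
  have hPb : P ≠ ⊥ := fun h => hI (le_bot_iff.mp (h ▸ hIP))
  have hprime : ∃ J : Ideal A, J ≠ ⊥ ∧ P * P.map τ = J.map (algebraMap A B) := by
    set q := P.comap (algebraMap A B) with hq
    have hq0 : q ≠ ⊥ := Ideal.IsIntegral.comap_ne_bot A hPb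
    by_cases hr : ∀ x, τ x - x ∈ P
    · have hPτ := map_conj_eq_self hτ hr
      rw [hPτ]
      have hqB : q.map (algebraMap A B) ≠ ⊥ := by
        rwa [Ne, Ideal.map_eq_bot_iff_of_injective (FaithfulSMul.algebraMap_injective A B)]
      have hnorm : ∀ y ∈ P, y * τ y ∈ q.map (algebraMap A B) := by
        intro y hy
        obtain ⟨a, ha⟩ := hfix (y * τ y) (by rw [map_mul, hτ, mul_comm])
        rw [← ha]
        apply Ideal.mem_map_of_mem
        rw [hq, Ideal.mem_comap, ha]
        exact P.mul_mem_right _ hy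
      have hPprime : Prime P := Ideal.prime_of_isPrime hPb hP.isPrime
      have hfin : FiniteMultiplicity P (q.map (algebraMap A B)) :=
        FiniteMultiplicity.of_prime_left hPprime hqB
      obtain ⟨R, hR, hRP⟩ := hfin.exists_eq_pow_mul_and_not_dvd
      set e := multiplicity P (q.map (algebraMap A B))
      have hRtop : R = ⊤ := by
        by_contra hRt
        obtain ⟨P', hP', hRP'⟩ := Ideal.exists_le_maximal R hRt
        have hqP' : q.map (algebraMap A B) ≤ P' := by
          rw [hR]; exact Ideal.mul_le_right.trans hRP'
        have : P ≤ P' ⊔ P' := by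
          by_contra hcon
          rw [sup_idem] at hcon
          obtain ⟨y, hy, hy'⟩ := Set.not_subset.mp hcon
          have hne : P'.map τ ≠ P := by
            intro h
            apply hcon
            have := map_conj_map_conj hτ P'
            rw [h, hPτ] at this
            exact this.le
          have hnle : ¬ P ≤ P'.map τ := by
            intro h
            have h2 : (P'.map τ) ≠ ⊤ := by
              intro h2
              have := map_conj_map_conj hτ P'
              rw [h2, Ideal.map_top] at this
              exact hP'.ne_top this.symm
            exact hne (hP.eq_of_le h2 h).symm
          have hsub : (P : Set B) ⊆ P' ∪ (P'.map τ : Ideal B) := by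
            intro y hy
            rcases hP'.isPrime.mem_or_mem (hqP' (hnorm y hy)) with h | h
            · exact Or.inl h
            · right
              have := Ideal.mem_map_of_mem τ h
              rwa [hτ] at this
          rcases (Ideal.subset_union).mp hsub with h | h
          · exact hcon h
          · exact hnle h
        rw [sup_idem] at this
        have := hP.eq_of_le hP'.ne_top this
        exact hRP (Ideal.dvd_iff_le.mpr (this ▸ hRP'))
      rw [hRtop, Ideal.mul_top] at hR
      have he0 : e ≠ 0 := by
        intro h
        rw [h, pow_zero, Ideal.one_eq_top] at hR
        exact hP.ne_top (top_le_iff.mp (hR ▸ Ideal.map_comap_le))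
      have he2 : e ≤ 2 := by
        have hlt : P ^ 2 < P := by
          simpa using Ideal.pow_right_strictAnti P hPb hP.ne_top (show 1 < 2 by norm_num)
        obtain ⟨y, hy, hy2⟩ := Set.exists_of_ssubset hlt
        by_contra hcon
        have h3 : y * τ y ∈ P ^ 3 := by
          have := hnorm y hy
          rw [hR] at this
          exact Ideal.pow_le_pow_right (by omega) this
        have hdy : ¬ P ^ 2 ∣ Ideal.span {y} := by
          rwa [Ideal.dvd_iff_le, Ideal.span_singleton_le_iff_mem]
        have hdτy : ¬ P ^ 2 ∣ Ideal.span {τ y} := by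
          rw [Ideal.dvd_iff_le, Ideal.span_singleton_le_iff_mem]
          intro h
          apply hy2
          have := Ideal.mem_map_of_mem τ h
          rwa [hτ, Ideal.map_pow, hPτ] at this
        have hd3 : P ^ 3 ∣ Ideal.span {y} * Ideal.span {τ y} := by
          rwa [Ideal.span_singleton_mul_span_singleton, Ideal.dvd_iff_le,
            Ideal.span_singleton_le_iff_mem]
        obtain ⟨Y, hY⟩ : P ∣ Ideal.span {y} := by
          rwa [Ideal.dvd_iff_le, Ideal.span_singleton_le_iff_mem]
        obtain ⟨Y', hY'⟩ : P ∣ Ideal.span {τ y} := by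
          rw [Ideal.dvd_iff_le, Ideal.span_singleton_le_iff_mem, ← hPτ]
          exact Ideal.mem_map_of_mem τ hy
        have hd1 : P ∣ Y * Y' := by
          rw [hY, hY', pow_succ, show P * Y * (P * Y') = P ^ 2 * (Y * Y') by ring] at hd3
          exact (mul_dvd_mul_iff_left (pow_ne_zero 2 hPb)).mp hd3
        rcases hPprime.2.2 _ _ hd1 with h | h
        · exact hdy (by rw [hY, sq]; exact mul_dvd_mul_left P h)
        · exact hdτy (by rw [hY', sq]; exact mul_dvd_mul_left P h)
      have : e = 1 ∨ e = 2 := by omega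
      rcases this with h | h
      · refine ⟨q ^ 2, pow_ne_zero _ hq0, ?_⟩
        rw [Ideal.map_pow, hR, h, pow_one, sq]
      · exact ⟨q, hq0, by rw [hR, h, sq]⟩
    · push Not at hr
      obtain ⟨x₀, hx₀⟩ := hr
      have hle : P ⊓ P.map τ ≤ q.map (algebraMap A B) := by
        rintro y ⟨hy, hy'⟩
        refine mem_map_comap_of_mem_of_conj_mem hτ hfix hP hx₀ hy ?_
        have := Ideal.mem_map_of_mem τ hy'
        rwa [map_conj_map_conj hτ] at this
      have hge1 : q.map (algebraMap A B) ≤ P := Ideal.map_comap_le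
      have hge2 : q.map (algebraMap A B) ≤ P.map τ := by
        rw [← map_conj_map_algebraMap (τ := τ)]
        exact Ideal.map_mono hge1
      have heq : P ⊓ P.map τ = q.map (algebraMap A B) := le_antisymm hle (le_inf hge1 hge2)
      by_cases hPτ : P.map τ = P
      · rw [hPτ, inf_idem] at heq
        refine ⟨q ^ 2, pow_ne_zero _ hq0, ?_⟩
        rw [hPτ, Ideal.map_pow, ← heq, sq]
      · refine ⟨q, hq0, ?_⟩
        rw [← heq]
        apply Ideal.mul_eq_inf_of_isCoprime
        rw [Ideal.isCoprime_iff_sup_eq]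
        by_contra hcon
        have h1 := hP.eq_of_le hcon le_sup_left
        have h2 : P.map τ ≤ P := by
          conv_rhs => rw [h1]
          exact le_sup_right
        have h3 := Ideal.map_mono (f := τ) h2
        rw [map_conj_map_conj hτ] at h3
        exact hPτ (le_antisymm h2 h3)
  obtain ⟨I', rfl⟩ := Ideal.dvd_iff_le.mpr hIP
  have hI'0 : I' ≠ ⊥ := by rintro rfl; simp at hI
  obtain ⟨J, hJ, hIJ⟩ := ih I' (lt_of_le_of_ne Ideal.mul_le_right (by
      intro h
      have : 1 * I' = P * I' := by rw [one_mul]; exact h.symm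
      have := mul_right_cancel₀ hI'0 this
      exact hP.ne_top (this.symm.trans Ideal.one_eq_top))) hI'0
  obtain ⟨J', hJ', hPJ⟩ := hprime
  refine ⟨J' * J, mul_ne_zero hJ' hJ, ?_⟩
  rw [Ideal.map_mul, Ideal.map_mul, ← hPJ, ← hIJ]
  ring

end Involution

section AmbiguousClasses

open scoped nonZeroDivisors

variable {A B : Type*} [CommRing A] [CommRing B] [Algebra A B] {τ : B ≃ₐ[A] B}

lemma pow_odd_eq_self {G : Type*} [Monoid G] {c : G} (hc : c ^ 2 = 1) {h : ℕ} (hh : Odd h) :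
    c ^ h = c := by
  obtain ⟨m, rfl⟩ := hh
  rw [pow_succ, pow_mul, hc, one_pow, one_mul]

lemma eq_pow_mul_sq_zpow {G : Type*} [CommGroup G] (w : G) {h : ℕ} (hh : Odd h) :
    ∃ v : ℤ, w = w ^ h * (w ^ v) ^ 2 := by
  obtain ⟨m, rfl⟩ := hh
  refine ⟨-m, ?_⟩
  rw [← zpow_natCast w (2 * m + 1), ← zpow_natCast (w ^ (-(m : ℤ))) 2, ← zpow_mul, ← zpow_add]
  conv_lhs => rw [← zpow_one w]
  congr 1
  push_cast
  ring

lemma conj_units_inv_eq (u : Bˣ) (hu : τ u = u) :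
    τ ((u⁻¹ : Bˣ) : B) = ((u⁻¹ : Bˣ) : B) := by
  have h1 : (u : B) * τ ((u⁻¹ : Bˣ) : B) = 1 := by
    conv_lhs => rw [← hu, ← map_mul, Units.mul_inv, map_one]
  exact Units.eq_inv_of_mul_eq_one_left h1

lemma exists_unit_of_conj_eq [FaithfulSMul A B]
    (hfix : ∀ x, τ x = x → ∃ a, algebraMap A B a = x) (u : Bˣ) (hu : τ u = u) :
    ∃ η : Aˣ, algebraMap A B η = u := by
  obtain ⟨a, ha⟩ := hfix u hu
  obtain ⟨b, hb⟩ := hfix _ (conj_units_inv_eq u hu)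
  have hab : a * b = 1 := by
    apply FaithfulSMul.algebraMap_injective A B
    rw [map_mul, ha, hb, map_one, Units.mul_inv]
  exact ⟨⟨a, b, hab, by rw [mul_comm, hab]⟩, ha⟩

lemma isPrincipal_pow_of_classGroup_pow [IsDedekindDomain A] {h : ℕ}
    (hA : ∀ c : ClassGroup A, c ^ h = 1) {J : Ideal A} (hJ : J ≠ ⊥) :
    ∃ a, a ≠ 0 ∧ J ^ h = Ideal.span {a} := by
  have h1 := hA (ClassGroup.mk0 ⟨J, mem_nonZeroDivisors_of_ne_zero hJ⟩)
  rw [← map_pow, ClassGroup.mk0_eq_one_iff] at h1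
  obtain ⟨a, ha⟩ := (Submodule.isPrincipal_iff _).mp h1
  have ha' : J ^ h = Ideal.span {a} := ha
  refine ⟨a, ?_, ha'⟩
  rintro rfl
  rw [Ideal.span_singleton_zero] at ha'
  exact pow_ne_zero h hJ ha'

lemma classGroup_mk0_pow_eq_one_of_eq_map [IsDedekindDomain A] [IsDedekindDomain B] {h : ℕ}
    (hA : ∀ c : ClassGroup A, c ^ h = 1) {J : Ideal A} (hJ : J ≠ ⊥) (I : (Ideal B)⁰)
    (hI : (I : Ideal B) = J.map (algebraMap A B)) : ClassGroup.mk0 I ^ h = 1 := by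
  obtain ⟨a, -, ha⟩ := isPrincipal_pow_of_classGroup_pow hA hJ
  rw [← map_pow, ClassGroup.mk0_eq_one_iff]
  rw [SubmonoidClass.coe_pow, hI, ← Ideal.map_pow, ha, Ideal.map_span, Set.image_singleton]
  exact ⟨⟨_, rfl⟩⟩

/-- The conjugate of a nonzero ideal. -/
noncomputable def conjIdeal [IsDedekindDomain B] (τ : B ≃ₐ[A] B) (I : (Ideal B)⁰) : (Ideal B)⁰ :=
  ⟨(I : Ideal B).map τ, mem_nonZeroDivisors_of_ne_zero
    (map_conj_ne_bot (nonZeroDivisors.coe_ne_zero I))⟩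

/-- A class of order two over a base of odd class number is fixed by conjugation. -/
lemma exists_conj_relation [IsDedekindDomain A] [IsDedekindDomain B] [Algebra.IsIntegral A B]
    [FaithfulSMul A B]
    (hτ : ∀ x, τ (τ x) = x) (hfix : ∀ x, τ x = x → ∃ a, algebraMap A B a = x)
    {h : ℕ} (hh : Odd h) (hA : ∀ c : ClassGroup A, c ^ h = 1)
    (c : ClassGroup B) (hc : c ^ 2 = 1) :
    ∃ (I : (Ideal B)⁰) (x y : B) (η : Aˣ), ClassGroup.mk0 I = c ∧ x ≠ 0 ∧ y ≠ 0 ∧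
      Ideal.span {x} * (I : Ideal B) = Ideal.span {y} * (I : Ideal B).map τ ∧
      x * τ x = algebraMap A B η * (y * τ y) := by
  obtain ⟨I, rfl⟩ := ClassGroup.mk0_surjective c
  have hI0 : (I : Ideal B) ≠ ⊥ := nonZeroDivisors.coe_ne_zero I
  have hτ2 : ClassGroup.mk0 (conjIdeal τ I) ^ 2 = 1 := by
    rw [← map_pow, ClassGroup.mk0_eq_one_iff] at hc ⊢
    obtain ⟨a, ha⟩ := (Submodule.isPrincipal_iff _).mp hc
    refine (Submodule.isPrincipal_iff _).mpr ⟨τ a, ?_⟩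
    change ((I : Ideal B).map τ) ^ 2 = Ideal.span {τ a}
    have ha' : (I : Ideal B) ^ 2 = Ideal.span {a} := ha
    rw [← Ideal.map_pow, ha', Ideal.map_span, Set.image_singleton]
  obtain ⟨J, hJ, hIJ⟩ := exists_mul_map_conj_eq_map hτ hfix I hI0
  have h1 := classGroup_mk0_pow_eq_one_of_eq_map hA hJ (I * conjIdeal τ I) hIJ
  rw [map_mul, mul_pow, pow_odd_eq_self hc hh, pow_odd_eq_self hτ2 hh] at h1
  have h2 : ClassGroup.mk0 I = ClassGroup.mk0 (conjIdeal τ I) := by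
    have h3 : ClassGroup.mk0 (conjIdeal τ I) * ClassGroup.mk0 (conjIdeal τ I) = 1 := by
      rw [← sq, hτ2]
    exact mul_right_cancel (h1.trans h3.symm)
  obtain ⟨x, y, hx, hy, hxy⟩ := ClassGroup.mk0_eq_mk0_iff.mp h2
  have hxy' : Ideal.span {x} * (I : Ideal B) = Ideal.span {y} * (I : Ideal B).map τ := hxy
  have hII : (I : Ideal B) * (I : Ideal B).map τ ≠ 0 := mul_ne_zero hI0 (map_conj_ne_bot hI0)
  have h4 : Ideal.span {x * τ x} = Ideal.span {y * τ y} := by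
    have h5 := congrArg (Ideal.map τ) hxy'
    rw [Ideal.map_mul, Ideal.map_mul, map_conj_map_conj hτ, Ideal.map_span, Ideal.map_span,
      Set.image_singleton, Set.image_singleton] at h5
    apply mul_right_cancel₀ hII
    rw [← Ideal.span_singleton_mul_span_singleton, ← Ideal.span_singleton_mul_span_singleton]
    calc Ideal.span {x} * Ideal.span {τ x} * ((I : Ideal B) * (I : Ideal B).map τ)
        = (Ideal.span {x} * (I : Ideal B)) * (Ideal.span {τ x} * (I : Ideal B).map τ) := by ring
      _ = _ := by rw [hxy', h5]; ring
  obtain ⟨u, hu⟩ := (Ideal.span_singleton_eq_span_singleton.mp h4).symm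
  have hu' : τ u = u := by
    have h6 := congrArg τ hu
    simp only [map_mul, hτ] at h6
    have hne : τ y * y ≠ 0 := mul_ne_zero (by simpa using hy) hy
    apply mul_left_cancel₀ hne
    rw [h6, mul_comm (τ x) x, ← hu, mul_comm (τ y) y]
  obtain ⟨η, hη⟩ := exists_unit_of_conj_eq hfix u hu'
  exact ⟨I, x, y, η, rfl, hx, hy, hxy', by rw [hη, ← hu]; ring⟩

/-- A class that is represented by an invariant ideal. -/
def IsAmbiguous [IsDedekindDomain B] (τ : B ≃ₐ[A] B) (c : ClassGroup B) : Prop :=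
  ∃ I : (Ideal B)⁰, (I : Ideal B).map τ = I ∧ ClassGroup.mk0 I = c

lemma isAmbiguous_of_conj_relation [IsDedekindDomain B]
    (hτ : ∀ x, τ (τ x) = x) (hne : ∃ x, τ x ≠ x) (I : (Ideal B)⁰) {x y : B} (hy : y ≠ 0)
    (hI : Ideal.span {x} * (I : Ideal B) = Ideal.span {y} * (I : Ideal B).map τ)
    (hxy : x * τ x = y * τ y) : IsAmbiguous τ (ClassGroup.mk0 I) := by
  obtain ⟨g, hg, hxg⟩ := exists_conj_ratio hτ hne hy hxy
  have hg' : Ideal.span {g} ∈ (Ideal B)⁰ :=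
    mem_nonZeroDivisors_of_ne_zero (by simpa using hg)
  refine ⟨⟨Ideal.span {g}, hg'⟩ * I, ?_, ?_⟩
  · change Ideal.map τ (Ideal.span {g} * (I : Ideal B)) = Ideal.span {g} * (I : Ideal B)
    rw [Ideal.map_mul, Ideal.map_span, Set.image_singleton]
    have hy' : Ideal.span {y} ≠ 0 := by simpa using hy
    apply mul_left_cancel₀ hy'
    calc Ideal.span {y} * (Ideal.span {τ g} * (I : Ideal B).map τ)
        = Ideal.span {τ g} * (Ideal.span {x} * (I : Ideal B)) := by rw [hI]; ring
      _ = Ideal.span {x * τ g} * (I : Ideal B) := by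
          rw [← Ideal.span_singleton_mul_span_singleton]; ring
      _ = _ := by rw [hxg, ← Ideal.span_singleton_mul_span_singleton]; ring
  · rw [map_mul, ClassGroup.mk0_eq_one_iff hg' |>.mpr ⟨⟨g, rfl⟩⟩, one_mul]

/-- Invariant ideals when the only ramified primes are `(π)` and `Q`. -/
lemma exists_eq_map_mul_span_pow_mul_pow [IsDedekindDomain A] [IsDedekindDomain B]
    [Algebra.IsIntegral A B] [FaithfulSMul A B]
    (hτ : ∀ x, τ (τ x) = x) (hfix : ∀ x, τ x = x → ∃ a, algebraMap A B a = x)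
    {π : B} {Q : Ideal B}
    (hram : ∀ P : Ideal B, P.IsPrime → P ≠ ⊥ → (∀ x, τ x - x ∈ P) → P = Ideal.span {π} ∨ P = Q)
    (I : Ideal B) (hI : I ≠ ⊥) (hinv : I.map τ = I) :
    ∃ (J : Ideal A) (i j : ℕ), J ≠ ⊥ ∧
      I = J.map (algebraMap A B) * Ideal.span {π} ^ i * Q ^ j := by
  let S : Submonoid (Ideal B) :=
    { carrier := {I | ∃ (J : Ideal A) (i j : ℕ), J ≠ ⊥ ∧
        I = J.map (algebraMap A B) * Ideal.span {π} ^ i * Q ^ j}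
      mul_mem' := by
        rintro _ _ ⟨J, i, j, hJ, rfl⟩ ⟨J', i', j', hJ', rfl⟩
        refine ⟨J * J', i + i', j + j', mul_ne_zero hJ hJ', ?_⟩
        rw [Ideal.map_mul]
        ring
      one_mem' := ⟨⊤, 0, 0, top_ne_bot, by simp [Ideal.map_top]⟩ }
  refine mem_submonoid_of_map_conj_eq hτ hfix S ?_ ?_ I hI hinv
  · exact fun J hJ => ⟨J, 0, 0, hJ, by simp⟩
  · intro P hP hP0 hPr
    rcases hram P hP hP0 hPr with h | h
    · exact ⟨⊤, 1, 0, top_ne_bot, by simp [Ideal.map_top, h]⟩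
    · exact ⟨⊤, 0, 1, top_ne_bot, by simp [Ideal.map_top, h]⟩

/-- A bound on the two-torsion of the class group of a quadratic extension ramified (at finite
primes) only at a principal prime and at most one further prime, in terms of units. -/
theorem ambiguous_class_bound [IsDedekindDomain A] [IsDedekindDomain B]
    [Algebra.IsIntegral A B] [FaithfulSMul A B]
    (hτ : ∀ x, τ (τ x) = x) (hfix : ∀ x, τ x = x → ∃ a, algebraMap A B a = x)
    (hne : ∃ x, τ x ≠ x)
    {h : ℕ} (hh : Odd h) (hA : ∀ c : ClassGroup A, c ^ h = 1)
    (δ : Aˣ)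
    (hδ : ∀ (η : Aˣ) (x y : B), y ≠ 0 → x * τ x = algebraMap A B η * (y * τ y) →
      (∃ e : Aˣ, η = e ^ 2) ∨ ∃ e : Aˣ, η = δ * e ^ 2)
    (hunit : (∀ (u : Bˣ) (η : Aˣ), (u : B) * τ u = algebraMap A B η → ∃ e : Aˣ, η = e ^ 2) →
      ∃ w : Bˣ, (w : B) * τ w = 1 ∧
        ∀ v : Bˣ, (v : B) * τ v = 1 → w ≠ v ^ 2 ∧ w ≠ -v ^ 2)
    {π : B} (hπ0 : π ≠ 0) (hπ : τ π = -π) {Q : Ideal B} (hQ0 : Q ≠ ⊥) (hQ : Q.map τ = Q)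
    (hram : ∀ P : Ideal B, P.IsPrime → P ≠ ⊥ → (∀ x, τ x - x ∈ P) →
      P = Ideal.span {π} ∨ P = Q) :
    (Q = ⊤ → ∀ c : ClassGroup B, c ^ 2 = 1 → c = 1) ∧
    (∀ c c' : ClassGroup B, c ^ 2 = 1 → c' ^ 2 = 1 → c ≠ 1 → c' ≠ 1 → c = c') := by
  have hQm : Q ∈ (Ideal B)⁰ := mem_nonZeroDivisors_of_ne_zero hQ0
  have hπm : Ideal.span {π} ∈ (Ideal B)⁰ :=
    mem_nonZeroDivisors_of_ne_zero (by simpa using hπ0)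
  obtain ⟨q, hq⟩ : ∃ q, q = ClassGroup.mk0 (⟨Q, hQm⟩ : (Ideal B)⁰) ^ h := ⟨_, rfl⟩
  have hq2 : q ^ 2 = 1 := by
    obtain ⟨J, hJ, hQJ⟩ := exists_mul_map_conj_eq_map hτ hfix Q hQ0
    rw [hQ] at hQJ
    have := classGroup_mk0_pow_eq_one_of_eq_map hA hJ ((⟨Q, hQm⟩ : (Ideal B)⁰) * ⟨Q, hQm⟩) hQJ
    rwa [map_mul, mul_pow, ← hq, ← sq] at this
  have hform : ∀ c : ClassGroup B, c ^ 2 = 1 → IsAmbiguous τ c → c = 1 ∨ c = q := by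
    rintro c hc ⟨I, hI, rfl⟩
    obtain ⟨J, i, j, hJ, hIJ⟩ := exists_eq_map_mul_span_pow_mul_pow hτ hfix hram I
      (nonZeroDivisors.coe_ne_zero I) hI
    have hJB : J.map (algebraMap A B) ≠ ⊥ := by
      rwa [Ne, Ideal.map_eq_bot_iff_of_injective (FaithfulSMul.algebraMap_injective A B)]
    have hI' : I = ⟨J.map (algebraMap A B), mem_nonZeroDivisors_of_ne_zero hJB⟩ *
        (⟨Ideal.span {π}, hπm⟩ : (Ideal B)⁰) ^ i * (⟨Q, hQm⟩ : (Ideal B)⁰) ^ j :=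
      Subtype.ext hIJ
    have hcq : ClassGroup.mk0 I = q ^ j := by
      rw [← pow_odd_eq_self hc hh, hI', map_mul, map_mul, map_pow, map_pow,
        ClassGroup.mk0_eq_one_iff hπm |>.mpr ⟨⟨π, rfl⟩⟩, one_pow, mul_one, mul_pow,
        classGroup_mk0_pow_eq_one_of_eq_map hA hJ _ rfl, one_mul, ← pow_mul, mul_comm j h, pow_mul,
        ← hq]
    rw [hcq]
    rcases Nat.even_or_odd j with hj | hj
    · left
      obtain ⟨m, rfl⟩ := hj
      rw [← two_mul, pow_mul, hq2, one_pow]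
    · right
      exact pow_odd_eq_self hq2 hj
  have hsq : ∀ (I : (Ideal B)⁰) (x y : B) (η e : Aˣ), y ≠ 0 →
      Ideal.span {x} * (I : Ideal B) = Ideal.span {y} * (I : Ideal B).map τ →
      x * τ x = algebraMap A B η * (y * τ y) → η = e ^ 2 →
      IsAmbiguous τ (ClassGroup.mk0 I) := by
    intro I x y η e hy hI hxy he
    have hu : IsUnit (algebraMap A B e) := e.isUnit.map _
    refine isAmbiguous_of_conj_relation hτ hne I (x := x) (y := algebraMap A B e * y)
      (mul_ne_zero hu.ne_zero hy) ?_ ?_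
    · rw [hI, Ideal.span_singleton_mul_left_unit hu]
    · rw [hxy, he, map_mul, AlgEquiv.commutes, Units.val_pow_eq_pow_val, map_pow]
      ring
  by_cases hcase : ∀ (u : Bˣ) (η : Aˣ), (u : B) * τ u = algebraMap A B η → ∃ e : Aˣ, η = e ^ 2
  · obtain ⟨w, hw, hwsq⟩ := hunit hcase
    obtain ⟨g, hg, hwg⟩ := exists_conj_ratio hτ hne (x := w) (y := 1) one_ne_zero
      (by rw [hw, map_one, mul_one])
    rw [one_mul] at hwg
    have hginv : (Ideal.span {g}).map τ = Ideal.span {g} := by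
      rw [Ideal.map_span, Set.image_singleton]
      conv_rhs => rw [← hwg, Ideal.span_singleton_mul_left_unit w.isUnit]
    obtain ⟨J, i, j, hJ, hgJ⟩ := exists_eq_map_mul_span_pow_mul_pow hτ hfix hram _
      (by simpa using hg) hginv
    have key : ¬ ∃ J' : Ideal A, J' ≠ ⊥ ∧ Q ^ j = J'.map (algebraMap A B) := by
      rintro ⟨J', hJ', hQJ'⟩
      rw [hQJ', mul_right_comm, ← Ideal.map_mul] at hgJ
      obtain ⟨a, ha0, ha⟩ := isPrincipal_pow_of_classGroup_pow hA (mul_ne_zero hJ hJ')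
      have h1 : Ideal.span {algebraMap A B a * π ^ (i * h)} = Ideal.span {g ^ h} := by
        rw [← Ideal.span_singleton_pow, hgJ, mul_pow, ← Ideal.map_pow, ha, Ideal.map_span,
          Set.image_singleton, ← pow_mul, Ideal.span_singleton_pow,
          Ideal.span_singleton_mul_span_singleton]
      obtain ⟨e, he⟩ := Ideal.span_singleton_eq_span_singleton.mp h1
      obtain ⟨η, hη⟩ := exists_unit_of_conj_eq hfix (e * Units.map (τ : B →* B) e) (by
        simp only [Units.val_mul, map_mul, Units.coe_map, MonoidHom.coe_coe]
        change τ e * τ (τ e) = e * τ e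
        rw [hτ, mul_comm])
      have hη' : (e : B) * τ e = algebraMap A B η := by rw [hη]; rfl
      obtain ⟨s, rfl⟩ := hcase e η hη'
      set s' : Bˣ := Units.map (algebraMap A B : A →* B) s with hs'
      have hs'c : (s' : B) = algebraMap A B s := rfl
      have hτs : τ s' = s' := by rw [hs'c, AlgEquiv.commutes]
      have hτsinv := conj_units_inv_eq s' hτs
      have hee : (e : B) * τ e = s' ^ 2 := by
        rw [hη', hs'c, Units.val_pow_eq_pow_val, map_pow]
      have hN : ((e * s'⁻¹ : Bˣ) : B) * τ ((e * s'⁻¹ : Bˣ) : B) = 1 := by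
        rw [Units.val_mul, map_mul, hτsinv]
        have h2 : (s' : B) * ((s'⁻¹ : Bˣ) : B) = 1 := s'.mul_inv
        linear_combination ((s'⁻¹ : Bˣ) : B) ^ 2 * hee +
          ((s' : B) * ((s'⁻¹ : Bˣ) : B) + 1) * h2
      have hgτ : ((w : B) ^ h) * τ (g ^ h) = g ^ h := by
        rw [map_pow, ← mul_pow, hwg]
      have hπne : algebraMap A B a * π ^ (i * h) ≠ 0 := by
        refine mul_ne_zero ?_ (pow_ne_zero _ hπ0)
        rwa [Ne, FaithfulSMul.algebraMap_eq_zero_iff]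
      have hwh : (w : B) ^ h = ((e * s'⁻¹ : Bˣ) : B) ^ 2 ∨
          (w : B) ^ h = -((e * s'⁻¹ : Bˣ) : B) ^ 2 := by
        rw [← he] at hgτ
        simp only [map_mul, map_pow, AlgEquiv.commutes, hπ] at hgτ
        have h2 : (s' : B) * ((s'⁻¹ : Bˣ) : B) = 1 := s'.mul_inv
        have hx : ((e * s'⁻¹ : Bˣ) : B) ^ 2 * τ e = e := by
          rw [Units.val_mul]
          linear_combination (e : B) * ((s'⁻¹ : Bˣ) : B) ^ 2 * hee +
            (e : B) * ((s' : B) * ((s'⁻¹ : Bˣ) : B) + 1) * h2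
        have hτe : τ (e : B) ≠ 0 := by simp
        rcases Nat.even_or_odd (i * h) with hi | hi
        · left
          rw [hi.neg_pow] at hgτ
          apply mul_left_cancel₀ (mul_ne_zero hπne hτe)
          linear_combination hgτ - (algebraMap A B a * π ^ (i * h)) * hx
        · right
          rw [hi.neg_pow] at hgτ
          apply mul_left_cancel₀ (mul_ne_zero hπne hτe)
          linear_combination -hgτ + (algebraMap A B a * π ^ (i * h)) * hx
      obtain ⟨v, hv⟩ := eq_pow_mul_sq_zpow w hh
      have hτm : ∀ u : Bˣ, (u : B) * τ u = 1 ↔ u * Units.map (τ : B →* B) u = 1 := by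
        intro u
        rw [← Units.val_inj]
        rfl
      have hwv : ((w ^ v : Bˣ) : B) * τ ((w ^ v : Bˣ) : B) = 1 := by
        rw [hτm] at hw ⊢
        rw [map_zpow, ← mul_zpow, hw, one_zpow]
      have hprod : ((e * s'⁻¹ * w ^ v : Bˣ) : B) * τ ((e * s'⁻¹ * w ^ v : Bˣ) : B) = 1 := by
        rw [hτm] at hN hwv ⊢
        rw [map_mul, mul_mul_mul_comm, hN, hwv, one_mul]
      obtain ⟨hn1, hn2⟩ := hwsq _ hprod
      rcases hwh with hwh | hwh
      · apply hn1
        rw [mul_pow]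
        have : w ^ h = (e * s'⁻¹) ^ 2 := Units.ext (by simpa using hwh)
        rw [← this]
        exact hv
      · apply hn2
        rw [mul_pow, ← neg_mul]
        have : w ^ h = -(e * s'⁻¹) ^ 2 := Units.ext (by simpa using hwh)
        rw [← this]
        exact hv
    have hQt : Q ≠ ⊤ := by
      rintro rfl
      exact key ⟨⊤, top_ne_bot, by rw [Ideal.map_top, ← Ideal.one_eq_top, one_pow]⟩
    refine ⟨fun h => absurd h hQt, ?_⟩
    have hjodd : Odd j := by
      rw [← Nat.not_even_iff_odd]
      rintro ⟨m, hm⟩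
      obtain ⟨J', hJ', hQJ'⟩ := exists_mul_map_conj_eq_map hτ hfix Q hQ0
      rw [hQ] at hQJ'
      exact key ⟨J' ^ m, pow_ne_zero _ hJ', by rw [Ideal.map_pow, ← hQJ', ← sq, ← pow_mul, hm,
        two_mul]⟩
    have hq1 : q = 1 := by
      have hJB : J.map (algebraMap A B) ≠ ⊥ := by
        rwa [Ne, Ideal.map_eq_bot_iff_of_injective (FaithfulSMul.algebraMap_injective A B)]
      have hgm : Ideal.span {g} ∈ (Ideal B)⁰ :=
        mem_nonZeroDivisors_of_ne_zero (by simpa using hg)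
      have hI' : (⟨Ideal.span {g}, hgm⟩ : (Ideal B)⁰) =
          ⟨J.map (algebraMap A B), mem_nonZeroDivisors_of_ne_zero hJB⟩ *
          (⟨Ideal.span {π}, hπm⟩ : (Ideal B)⁰) ^ i * (⟨Q, hQm⟩ : (Ideal B)⁰) ^ j :=
        Subtype.ext hgJ
      have h1 := congrArg (fun I => ClassGroup.mk0 I ^ h) hI'
      simp only [map_mul, map_pow] at h1
      rw [ClassGroup.mk0_eq_one_iff hπm |>.mpr ⟨⟨π, rfl⟩⟩, one_pow, mul_one, mul_pow,
        classGroup_mk0_pow_eq_one_of_eq_map hA hJ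
          ⟨J.map (algebraMap A B), mem_nonZeroDivisors_of_ne_zero hJB⟩ rfl, one_mul, ← pow_mul, mul_comm j h, pow_mul,
        ← hq, ClassGroup.mk0_eq_one_iff hgm |>.mpr ⟨⟨g, rfl⟩⟩, one_pow,
        pow_odd_eq_self hq2 hjodd] at h1
      exact h1.symm
    intro c c' hc hc' hc1 hc1'
    obtain ⟨I, x, y, η, rfl, hx, hy, hI, hxy⟩ := exists_conj_relation hτ hfix hh hA c hc
    obtain ⟨I', x', y', η', rfl, hx', hy', hI', hxy'⟩ := exists_conj_relation hτ hfix hh hA c' hc'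
    have hnot : ∀ c : ClassGroup B, c ^ 2 = 1 → c ≠ 1 → ¬ IsAmbiguous τ c := by
      intro c hc hc1 hamb
      rcases hform c hc hamb with h | h
      · exact hc1 h
      · exact hc1 (h.trans hq1)
    obtain ⟨e, he⟩ := (hδ η x y hy hxy).resolve_left
      (fun ⟨e, he⟩ => hnot _ hc hc1 (hsq I x y η e hy hI hxy he))
    obtain ⟨e', he'⟩ := (hδ η' x' y' hy' hxy').resolve_left
      (fun ⟨e, he⟩ => hnot _ hc' hc1' (hsq I' x' y' η' e hy' hI' hxy' he))
    have hamb : IsAmbiguous τ (ClassGroup.mk0 (I * I')) := by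
      refine hsq (I * I') (x * x') (y * y') (η * η') (δ * e * e') (mul_ne_zero hy hy') ?_ ?_ ?_
      · change Ideal.span {x * x'} * ((I : Ideal B) * I') =
          Ideal.span {y * y'} * ((I : Ideal B) * I').map τ
        rw [Ideal.map_mul, ← Ideal.span_singleton_mul_span_singleton,
          ← Ideal.span_singleton_mul_span_singleton, mul_mul_mul_comm, hI, hI', mul_mul_mul_comm]
      · simp only [map_mul, Units.val_mul]
        linear_combination (x' * τ x') * hxy + (algebraMap A B η * (y * τ y)) * hxy'
      · rw [he, he', mul_pow, mul_pow, sq δ]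
        exact mul_mul_mul_comm δ (e ^ 2) δ (e' ^ 2) |>.trans (by rw [mul_assoc (δ * δ)])
    have hcc : (ClassGroup.mk0 I * ClassGroup.mk0 I') ^ 2 = 1 := by rw [mul_pow, hc, hc', one_mul]
    have h1 : ClassGroup.mk0 I * ClassGroup.mk0 I' = 1 := by
      by_contra hcon
      rw [map_mul] at hamb
      exact hnot _ hcc hcon hamb
    rw [sq] at hc'
    exact mul_right_cancel (h1.trans hc'.symm)
  · push Not at hcase
    obtain ⟨u, η₀, hu, hη₀⟩ := hcase
    obtain ⟨e₀, he₀⟩ := (hδ η₀ u 1 one_ne_zero (by rw [hu, map_one]; ring)).resolve_left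
      (fun ⟨e, he⟩ => hη₀ e he)
    have hall : ∀ c : ClassGroup B, c ^ 2 = 1 → c = 1 ∨ c = q := by
      intro c hc
      apply hform c hc
      obtain ⟨I, x, y, η, rfl, hx, hy, hI, hxy⟩ := exists_conj_relation hτ hfix hh hA c hc
      rcases hδ η x y hy hxy with ⟨e, he⟩ | ⟨e, he⟩
      · exact hsq I x y η e hy hI hxy he
      · refine hsq I (u * x) y (η₀ * η) (δ * e₀ * e) hy ?_ ?_ ?_
        · rw [Ideal.span_singleton_mul_left_unit u.isUnit, hI]
        · simp only [map_mul, Units.val_mul]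
          linear_combination (x * τ x) * hu + algebraMap A B η₀ * hxy
        · rw [he, he₀, mul_pow, mul_pow, sq δ]
          exact mul_mul_mul_comm δ (e₀ ^ 2) δ (e ^ 2) |>.trans (by rw [mul_assoc (δ * δ)])
    constructor
    · rintro rfl c hc
      have hq1 : q = 1 := by
        rw [hq, ClassGroup.mk0_eq_one_iff hQm |>.mpr ⟨⟨1, by simp⟩⟩, one_pow]
      rcases hall c hc with h | h
      · exact h
      · exact h.trans hq1
    · intro c c' hc hc' hc1 hc1'
      rw [(hall c hc).resolve_left hc1, (hall c' hc').resolve_left hc1']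

/-- Hilbert's Theorem 94 for quadratic extensions: in an extension without ramified primes, a unit
of norm one that is not a quotient of conjugate units forces an even class number. -/
theorem not_odd_of_unramified_of_unit [IsDedekindDomain A] [IsDedekindDomain B]
    [Algebra.IsIntegral A B] [FaithfulSMul A B]
    (hτ : ∀ x, τ (τ x) = x) (hfix : ∀ x, τ x = x → ∃ a, algebraMap A B a = x)
    (hne : ∃ x, τ x ≠ x)
    {h : ℕ} (hA : ∀ c : ClassGroup A, c ^ h = 1)
    (hram : ∀ P : Ideal B, P.IsPrime → P ≠ ⊥ → ¬ ∀ x, τ x - x ∈ P)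
    (w : Bˣ) (hw : (w : B) * τ w = 1) (hwn : ∀ e : Bˣ, (w : B) * τ e ≠ e) : ¬ Odd h := by
  intro hh
  obtain ⟨g, hg, hwg⟩ := exists_conj_ratio hτ hne (x := w) (y := 1) one_ne_zero
    (by rw [hw, map_one, mul_one])
  rw [one_mul] at hwg
  have hginv : (Ideal.span {g}).map τ = Ideal.span {g} := by
    rw [Ideal.map_span, Set.image_singleton]
    conv_rhs => rw [← hwg, Ideal.span_singleton_mul_left_unit w.isUnit]
  obtain ⟨J, i, j, hJ, hgJ⟩ := exists_eq_map_mul_span_pow_mul_pow hτ hfix (π := 1) (Q := ⊤)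
    (fun P h1 h2 h3 => absurd h3 (hram P h1 h2)) _ (by simpa using hg) hginv
  rw [Ideal.span_singleton_one, ← Ideal.one_eq_top, one_pow, one_pow, mul_one, mul_one] at hgJ
  obtain ⟨a, ha0, ha⟩ := isPrincipal_pow_of_classGroup_pow hA hJ
  have h1 : Ideal.span {algebraMap A B a} = Ideal.span {g ^ h} := by
    rw [← Ideal.span_singleton_pow, hgJ, ← Ideal.map_pow, ha, Ideal.map_span, Set.image_singleton]
  obtain ⟨e, he⟩ := Ideal.span_singleton_eq_span_singleton.mp h1
  have hτm : ∀ u v : Bˣ, (u : B) * τ v = v ↔ u = v / Units.map (τ : B →* B) v := by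
    intro u v
    rw [eq_div_iff_mul_eq', ← Units.val_inj]
    rfl
  have hwh : w ^ h = e / Units.map (τ : B →* B) e := by
    rw [← hτm, Units.val_pow_eq_pow_val]
    have hgτ : ((w : B) ^ h) * τ (g ^ h) = g ^ h := by rw [map_pow, ← mul_pow, hwg]
    rw [← he, map_mul, AlgEquiv.commutes] at hgτ
    have ha' : algebraMap A B a ≠ 0 := by rwa [Ne, FaithfulSMul.algebraMap_eq_zero_iff]
    apply mul_left_cancel₀ ha'
    linear_combination hgτ
  have hw2 : w ^ 2 = w / Units.map (τ : B →* B) w := by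
    have : w * Units.map (τ : B →* B) w = 1 := Units.ext hw
    rw [eq_div_iff_mul_eq', sq, mul_assoc, this, mul_one]
  obtain ⟨v, hv⟩ := eq_pow_mul_sq_zpow w hh
  refine hwn (e * w ^ v) ((hτm _ _).mpr ?_)
  rw [map_mul, map_zpow, mul_div_mul_comm, ← hwh, ← div_zpow, ← hw2]
  conv_lhs => rw [hv]
  congr 1
  rw [← zpow_natCast, ← zpow_mul, ← zpow_natCast w 2, ← zpow_mul, mul_comm v]

end AmbiguousClasses

section UnitIndices

/-- The subgroup of squares. -/
abbrev squares (G : Type*) [CommGroup G] : Subgroup G := (powMonoidHom 2 : G →* G).range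

lemma mem_squares {G : Type*} [CommGroup G] {x : G} : x ∈ squares G ↔ ∃ e, x = e ^ 2 :=
  ⟨fun ⟨e, he⟩ => ⟨e, he.symm⟩, fun ⟨e, he⟩ => ⟨e, he.symm⟩⟩

theorem index_squares_units (K : Type*) [Field K] [NumberField K] :
    (squares (𝓞 K)ˣ).index = 2 ^ (Units.rank K + 1) := by
  set T := Units.torsion K with hT
  set S := squares (𝓞 K)ˣ with hS
  have h1 : (S ⊔ T).index = 2 ^ Units.rank K := by
    have h2 := AddSubgroup.index_range_nsmul (Additive ((𝓞 K)ˣ ⧸ T)) 2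
    rw [Units.finrank_modTorsion] at h2
    have h3 : (squares ((𝓞 K)ˣ ⧸ T)).index = 2 ^ Units.rank K := by
      rw [← h2]
      rfl
    rw [← h3, ← Subgroup.index_comap_of_surjective _ (QuotientGroup.mk'_surjective T)]
    congr 1
    have h4 : squares ((𝓞 K)ˣ ⧸ T) = S.map (QuotientGroup.mk' T) := by
      ext x
      rw [Subgroup.mem_map]
      constructor
      · rintro ⟨e, rfl⟩
        obtain ⟨e, rfl⟩ := QuotientGroup.mk'_surjective T e
        exact ⟨e ^ 2, ⟨e, rfl⟩, by simp⟩
      · rintro ⟨_, ⟨e, rfl⟩, rfl⟩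
        exact ⟨QuotientGroup.mk' T e, by simp⟩
    rw [h4, Subgroup.comap_map_eq, QuotientGroup.ker_mk']
  have h2 : S.relIndex T = 2 := by
    have h3 : S.subgroupOf T = squares T := by
      ext x
      rw [Subgroup.mem_subgroupOf]
      constructor
      · rintro ⟨e, he⟩
        have he' : e ∈ T := by
          have hx : e ^ 2 ∈ CommGroup.torsion (𝓞 K)ˣ := by
            have h := x.2
            rwa [← he] at h
          exact (isOfFinOrder_pow.mp hx).resolve_right two_ne_zero
        exact ⟨⟨e, he'⟩, Subtype.ext he⟩
      · rintro ⟨e, rfl⟩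
        exact ⟨e, rfl⟩
    rw [Subgroup.relIndex, h3, IsCyclic.index_powMonoidHom_range]
    exact Nat.gcd_eq_right (Units.even_torsionOrder K).two_dvd
  rw [← Subgroup.relIndex_mul_index (le_sup_left : S ≤ S ⊔ T), Subgroup.relIndex_sup_left, h2, h1,
    pow_succ, mul_comm]

variable {U E : Type*} [CommGroup U] [CommGroup E] {ι : U →* E} {τ : E →* E} {N : E →* U}

lemma exists_norm_one_ne_sq (hιN : ∀ e, ι (N e) = e * τ e) (hτι : ∀ s, τ (ι s) = ι s)
    (s₀ : U)
    [(squares U).FiniteIndex] (hlt : (squares U).index < (squares E).index)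
    (hN : ∀ e, N e ∈ squares U) :
    ∃ w, w * τ w = 1 ∧ ∀ v, v * τ v = 1 → w ≠ v ^ 2 ∧ w ≠ ι s₀ * v ^ 2 := by
  by_contra! hcon
  have htop : squares E ⊔ ι.range = ⊤ := by
    rw [eq_top_iff]
    intro e _
    obtain ⟨s, hs⟩ := mem_squares.mp (hN e)
    have hes : e * τ e = ι s ^ 2 := by rw [← hιN, hs, map_pow]
    have h1 : e * (ι s)⁻¹ * τ (e * (ι s)⁻¹) = 1 := by
      rw [map_mul, map_inv, hτι, mul_mul_mul_comm, hes, sq, ← mul_inv, mul_inv_cancel]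
    obtain ⟨v, hv, hw⟩ := hcon _ h1
    have h2 : e = e * (ι s)⁻¹ * ι s := by rw [inv_mul_cancel_right]
    by_cases h3 : e * (ι s)⁻¹ = v ^ 2
    · rw [h2, h3]
      exact Subgroup.mul_mem_sup ⟨v, rfl⟩ ⟨s, rfl⟩
    · rw [h2, hw h3, mul_right_comm, mul_comm]
      exact Subgroup.mul_mem_sup ⟨v, rfl⟩ (mul_mem ⟨s₀, rfl⟩ ⟨s, rfl⟩)
  have h1 : (squares E).index = ((squares E).comap ι).index := by
    rw [Subgroup.index_comap, ← Subgroup.relIndex_sup_left, htop, Subgroup.relIndex_top_right]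
  have h2 : squares U ≤ (squares E).comap ι := by
    rintro _ ⟨e, rfl⟩
    exact ⟨ι e, by simp⟩
  have := Subgroup.index_antitone h2
  omega

lemma exists_norm_one_ne_div (hιN : ∀ e, ι (N e) = e * τ e) (hτι : ∀ s, τ (ι s) = ι s)
    [(squares U).FiniteIndex]
    (hlt : (squares U).index ^ 2 < 2 * (squares E).index) {s₀ : U} (hs₀ : s₀ ^ 2 = 1)
    (hu : ∀ u s, ι s₀ = u / τ u → u ^ 2 ≠ ι s ^ 2) :
    ∃ w, w * τ w = 1 ∧ ∀ v, w ≠ v / τ v := by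
  by_contra! hcon
  set Q := (squares U).comap N with hQ
  have hQd : Q.index ∣ (squares U).index := by
    rw [hQ, Subgroup.index_comap]
    exact Subgroup.relIndex_dvd_index_of_normal _ _
  have hQ0 : Q.FiniteIndex := ⟨ne_zero_of_dvd_ne_zero Subgroup.FiniteIndex.index_ne_zero hQd⟩
  have hQi : Q.index ≤ (squares U).index :=
    Nat.le_of_dvd (Nat.pos_of_ne_zero Subgroup.FiniteIndex.index_ne_zero) hQd
  have hQle : Q ≤ squares E ⊔ ι.range := by
    intro e he
    obtain ⟨s, hs⟩ := mem_squares.mp he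
    have hes : e * τ e = ι s ^ 2 := by rw [← hιN, hs, map_pow]
    have h1 : e * (ι s)⁻¹ * τ (e * (ι s)⁻¹) = 1 := by
      rw [map_mul, map_inv, hτι, mul_mul_mul_comm, hes, sq, ← mul_inv, mul_inv_cancel]
    obtain ⟨v, hv⟩ := hcon _ h1
    have h2 : e = v ^ 2 * ι (s * (N v)⁻¹) := by
      rw [map_mul, map_inv, hιN, sq]
      rw [← div_eq_mul_inv, div_eq_iff_eq_mul] at hv
      rw [hv, div_eq_mul_inv, mul_inv]
      calc v * (τ v)⁻¹ * ι s = (v * v⁻¹) * v * (τ v)⁻¹ * ι s := by rw [mul_inv_cancel, one_mul]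
        _ = _ := by
          simp only [mul_comm, mul_left_comm, mul_assoc]
    rw [h2]
    exact Subgroup.mul_mem_sup ⟨v, rfl⟩ ⟨_, rfl⟩
  have h1 : (squares E ⊔ ι.range).index ≤ (squares U).index :=
    (Subgroup.index_antitone hQle).trans hQi
  have h2 : (squares E).index = ((squares E).comap ι).index * (squares E ⊔ ι.range).index := by
    rw [Subgroup.index_comap, ← Subgroup.relIndex_sup_left, Subgroup.relIndex_mul_index le_sup_left]
  have h3 : squares U ≤ (squares E).comap ι := by
    rintro _ ⟨e, rfl⟩
    exact ⟨ι e, by simp⟩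
  obtain ⟨u, hu'⟩ := hcon (ι s₀) (by rw [hτι, ← map_mul, ← sq, hs₀, map_one])
  have h4 : u ^ 2 = ι (s₀ * N u) := by
    rw [map_mul, hιN, hu', div_mul_eq_mul_div, mul_left_comm, ← mul_assoc, mul_div_cancel_right, sq]
  have h5 : squares U < (squares E).comap ι := by
    refine lt_of_le_of_ne h3 fun heq => ?_
    have h6 : s₀ * N u ∈ squares U := by
      rw [heq]
      exact ⟨u, h4⟩
    obtain ⟨s, hs⟩ := h6
    refine hu u s hu' ?_
    rw [h4, ← map_pow, ← hs]
    rfl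
  have h6 : 2 * ((squares E).comap ι).index ≤ (squares U).index := by
    rw [← Subgroup.relIndex_mul_index h3]
    refine Nat.mul_le_mul_right _ ?_
    have h7 : (squares U).relIndex ((squares E).comap ι) ≠ 1 := by
      rw [Ne, Subgroup.relIndex_eq_one]
      exact h5.not_ge
    have h8 : (squares U).relIndex ((squares E).comap ι) ≠ 0 := by
      intro h0
      have := Subgroup.relIndex_mul_index h3
      rw [h0, zero_mul] at this
      exact Subgroup.FiniteIndex.index_ne_zero this.symm
    omega
  nlinarith

end UnitIndices

section QuadraticUnits

variable {A B : Type*} [CommRing A] [CommRing B] [Algebra A B] {τ : B ≃ₐ[A] B}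

lemma exists_unit_norm [FaithfulSMul A B] (hτ : ∀ x, τ (τ x) = x)
    (hfix : ∀ x, τ x = x → ∃ a, algebraMap A B a = x) :
    ∃ N : Bˣ →* Aˣ, ∀ e, Units.map (algebraMap A B : A →* B) (N e) =
      e * Units.map (τ : B →* B) e := by
  have hinj : Function.Injective (Units.map (algebraMap A B : A →* B)) :=
    Units.map_injective (FaithfulSMul.algebraMap_injective A B)
  have hex : ∀ e : Bˣ, ∃ n : Aˣ, Units.map (algebraMap A B : A →* B) n =
      e * Units.map (τ : B →* B) e := by
    intro e
    obtain ⟨η, hη⟩ := exists_unit_of_conj_eq hfix (e * Units.map (τ : B →* B) e) (by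
      rw [Units.val_mul, map_mul]
      change τ e * τ (τ e) = e * τ e
      rw [hτ, mul_comm])
    exact ⟨η, Units.ext hη⟩
  choose N hN using hex
  refine ⟨MonoidHom.mk' N fun a b => hinj ?_, hN⟩
  rw [map_mul, hN, hN, hN, map_mul, mul_mul_mul_comm]

lemma exists_norm_one_unit_ne_sq [FaithfulSMul A B] (hτ : ∀ x, τ (τ x) = x)
    (hfix : ∀ x, τ x = x → ∃ a, algebraMap A B a = x)
    [(squares Aˣ).FiniteIndex] (hlt : (squares Aˣ).index < (squares Bˣ).index)
    (hN : ∀ (u : Bˣ) (η : Aˣ), (u : B) * τ u = algebraMap A B η → ∃ e : Aˣ, η = e ^ 2) :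
    ∃ w : Bˣ, (w : B) * τ w = 1 ∧
      ∀ v : Bˣ, (v : B) * τ v = 1 → w ≠ v ^ 2 ∧ w ≠ -v ^ 2 := by
  obtain ⟨N, hιN⟩ := exists_unit_norm hτ hfix
  obtain ⟨w, hw, hw'⟩ := exists_norm_one_ne_sq hιN
    (fun s => Units.ext (by simp)) (-1) hlt
    (fun e => mem_squares.mpr (hN e (N e) (by
      have := congrArg Units.val (hιN e)
      exact this.symm)))
  refine ⟨w, congrArg Units.val hw, fun v hv => ?_⟩
  obtain ⟨h1, h2⟩ := hw' v (Units.ext hv)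
  refine ⟨h1, fun h => h2 (h.trans (Units.ext ?_))⟩
  simp

lemma exists_norm_one_unit_ne_div [IsDomain B] [CharZero B] [FaithfulSMul A B]
    (hτ : ∀ x, τ (τ x) = x)
    (hfix : ∀ x, τ x = x → ∃ a, algebraMap A B a = x)
    [(squares Aˣ).FiniteIndex] (hlt : (squares Aˣ).index ^ 2 < 2 * (squares Bˣ).index) :
    ∃ w : Bˣ, (w : B) * τ w = 1 ∧ ∀ e : Bˣ, (w : B) * τ e ≠ e := by
  obtain ⟨N, hιN⟩ := exists_unit_norm hτ hfix
  obtain ⟨w, hw, hw'⟩ := exists_norm_one_ne_div hιN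
    (fun s => Units.ext (by simp)) hlt (s₀ := -1) (by simp) (by
      intro u s hu hus
      rw [eq_div_iff_mul_eq'] at hu
      have hu' : -τ u = u := by
        have h1 := congrArg Units.val hu
        simpa using h1
      have hs : ((u : B)) ^ 2 = (algebraMap A B s) ^ 2 := by
        have h1 := congrArg Units.val hus
        simpa using h1
      have hτu : τ u = u := by
        rcases sq_eq_sq_iff_eq_or_eq_neg.mp hs with h | h <;> rw [h] <;> simp
      rw [hτu] at hu'
      exact u.ne_zero (self_eq_neg.mp hu'.symm))
  refine ⟨w, congrArg Units.val hw, fun v hv => ?_⟩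
  apply hw' v
  rw [eq_div_iff_mul_eq']
  apply Units.ext
  exact hv

/-- Given a subgroup containing the squares with relative index at most two. -/
lemma exists_unit_mul_sq {U : Type*} [CommGroup U] (H : Subgroup U)
    (hH : (squares U).relIndex H ∣ 2) :
    ∃ δ, ∀ η ∈ H, (∃ e, η = e ^ 2) ∨ ∃ e, η = δ * e ^ 2 := by
  obtain ⟨a, -, ha⟩ := Subgroup.relIndex_dvd_two_iff.mp hH
  refine ⟨a, fun η hη => ?_⟩
  rcases ha η hη with h | h
  · right
    obtain ⟨e, he⟩ := mem_squares.mp h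
    refine ⟨e * a⁻¹, ?_⟩
    rw [mul_pow, ← he, sq, mul_comm]
    simp [mul_assoc]
  · exact Or.inl (mem_squares.mp h)

/-- If `-1` is not a relative norm and there are at most four square classes of units, then there
are at most two square classes of units that are relative norms. -/
lemma exists_unit_of_neg_one_not_norm [IsDomain B] [FaithfulSMul A B]
    (hidx : (squares Aˣ).index ∣ 4)
    (hneg : ∀ x y : B, y ≠ 0 → x * τ x ≠ -(y * τ y)) :
    ∃ δ : Aˣ, ∀ (η : Aˣ) (x y : B), y ≠ 0 → x * τ x = algebraMap A B η * (y * τ y) →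
      (∃ e : Aˣ, η = e ^ 2) ∨ ∃ e : Aˣ, η = δ * e ^ 2 := by
  let H : Subgroup Aˣ :=
    { carrier := {η | ∃ x y : B, y ≠ 0 ∧ x * τ x = algebraMap A B η * (y * τ y)}
      one_mem' := ⟨1, 1, one_ne_zero, by simp⟩
      mul_mem' := by
        rintro a b ⟨x, y, hy, h⟩ ⟨x', y', hy', h'⟩
        refine ⟨x * x', y * y', mul_ne_zero hy hy', ?_⟩
        simp only [map_mul, Units.val_mul]
        linear_combination (x' * τ x') * h + (algebraMap A B a * (y * τ y)) * h'
      inv_mem' := by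
        rintro a ⟨x, y, hy, h⟩
        have hx : x ≠ 0 := by
          rintro rfl
          rw [zero_mul, eq_comm, mul_eq_zero] at h
          rcases h with h | h
          · exact (a.isUnit.map (algebraMap A B)).ne_zero h
          · exact mul_ne_zero hy (by simpa using hy) h
        refine ⟨y, x, hx, ?_⟩
        rw [h, ← mul_assoc, ← map_mul, Units.inv_mul, map_one, one_mul] }
  have hsq : squares Aˣ ≤ H := by
    rintro _ ⟨e, rfl⟩
    exact ⟨algebraMap A B e, 1, one_ne_zero, by simp [sq]⟩
  have hne : H.index ≠ 1 := by
    rw [Ne, Subgroup.index_eq_one]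
    intro htop
    have h1 : (-1 : Aˣ) ∈ H := htop ▸ Subgroup.mem_top _
    obtain ⟨x, y, hy, h⟩ := h1
    exact hneg x y hy (by rw [h]; simp)
  have hmul := Subgroup.relIndex_mul_index hsq
  obtain ⟨δ, hδ⟩ := exists_unit_mul_sq H (by
    have h4 : (squares Aˣ).relIndex H * H.index ∣ 4 := hmul ▸ hidx
    have h5 : H.index ∣ 4 := (Dvd.intro_left _ rfl).trans h4
    have h6 : 2 ∣ H.index := by
      have : H.index ∣ 2 ^ 2 := h5
      obtain ⟨k, hk, hk'⟩ := (Nat.dvd_prime_pow Nat.prime_two).mp this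
      rw [hk'] at hne ⊢
      exact dvd_pow_self 2 (by rintro rfl; exact hne rfl)
    have h7 : (squares Aˣ).relIndex H * 2 ∣ 2 * 2 := (mul_dvd_mul_left _ h6).trans h4
    exact Nat.dvd_of_mul_dvd_mul_right two_pos h7)
  exact ⟨δ, fun η x y hy h => hδ η ⟨x, y, hy, h⟩⟩

end QuadraticUnits

section QuadraticExtension

variable {K L : Type*} [Field K] [Field L] [Algebra K L]

/-- The nontrivial automorphism of a quadratic extension generated by a square root. -/
lemma exists_conj_of_sq_mem [CharZero K] (hKL : Module.finrank K L = 2) {x : L} {d : K}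
    (hx : x ^ 2 = algebraMap K L d) (hxK : ∀ y, algebraMap K L y ≠ x) :
    ∃ σ : L ≃ₐ[K] L, σ x = -x ∧ (∀ y, σ (σ y) = y) ∧
      ∀ y, σ y = y → ∃ a, algebraMap K L a = y := by
  have : FiniteDimensional K L := Module.finite_of_finrank_eq_succ hKL
  have : Algebra.IsQuadraticExtension K L := ⟨hKL⟩
  have : IsGalois K L := inferInstance
  have hcard : Nat.card (L ≃ₐ[K] L) = 2 := by rw [IsGalois.card_aut_eq_finrank, hKL]
  have hex : ∃ σ : L ≃ₐ[K] L, σ x ≠ x := by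
    by_contra! h
    obtain ⟨y, hy⟩ := (IsGalois.mem_range_algebraMap_iff_fixed x).mpr h
    exact hxK y hy
  obtain ⟨σ, hσ⟩ := hex
  have hσ1 : σ ≠ 1 := by
    rintro rfl
    exact hσ rfl
  have hσx : σ x = -x := by
    have h1 : σ x ^ 2 = x ^ 2 := by rw [← map_pow, hx, AlgEquiv.commutes]
    exact (sq_eq_sq_iff_eq_or_eq_neg.mp h1).resolve_left hσ
  obtain ⟨ρ, hρ, hρ'⟩ := (Nat.card_eq_two_iff' (1 : L ≃ₐ[K] L)).mp hcard
  have hσρ := hρ' σ hσ1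
  refine ⟨σ, hσx, fun y => ?_, fun y hy => (IsGalois.mem_range_algebraMap_iff_fixed y).mpr ?_⟩
  · have h1 : σ ^ 2 = 1 := by rw [← hcard, pow_card_eq_one']
    have h2 := DFunLike.congr_fun h1 y
    rwa [sq] at h2
  · intro f
    by_cases hf : f = 1
    · rw [hf]
      rfl
    · rw [hρ' f hf, ← hσρ, hy]

/-- The restriction of an automorphism to the ring of integers. -/
noncomputable abbrev intConj (σ : L ≃ₐ[K] L) : 𝓞 L ≃ₐ[𝓞 K] 𝓞 L :=
  RingOfIntegers.mapAlgEquiv σ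

lemma intConj_intConj {σ : L ≃ₐ[K] L} (hσ : ∀ y, σ (σ y) = y) (x : 𝓞 L) :
    intConj σ (intConj σ x) = x :=
  RingOfIntegers.ext (hσ x)

lemma exists_of_intConj_eq {σ : L ≃ₐ[K] L} (hfix : ∀ y, σ y = y → ∃ a, algebraMap K L a = y)
    (x : 𝓞 L) (hx : intConj σ x = x) : ∃ a, algebraMap (𝓞 K) (𝓞 L) a = x := by
  obtain ⟨a, ha⟩ := hfix x (congrArg (algebraMap (𝓞 L) L) hx)
  have hint : IsIntegral ℤ a := by
    have h1 : IsIntegral ℤ (algebraMap K L a) := ha ▸ x.isIntegral_coe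
    exact (isIntegral_algebraMap_iff (algebraMap K L).injective).mp h1
  exact ⟨⟨a, hint⟩, RingOfIntegers.ext ha⟩

end QuadraticExtension

section QuadraticField

lemma isPrime_span_of_pow_finrank_eq {F : Type*} [Field F] [NumberField F] {p : ℕ} (hp : p.Prime)
    {x : 𝓞 F} (hx : x ^ Module.finrank ℚ F = p) : (Ideal.span {x}).IsPrime := by
  apply Ideal.isPrime_of_irreducible_absNorm
  rw [Ideal.absNorm_span_singleton]
  have h1 : (Algebra.norm ℤ x).natAbs ^ Module.finrank ℚ F = p ^ Module.finrank ℚ F := by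
    rw [← Int.natAbs_pow, ← map_pow, hx]
    have : (p : 𝓞 F) = algebraMap ℤ (𝓞 F) p := by simp
    rw [this, Algebra.norm_algebraMap, RingOfIntegers.rank]
    simp [Int.natAbs_pow]
  rw [(Nat.pow_left_inj Module.finrank_pos.ne').mp h1]
  exact hp

lemma exists_eq_add_mul {K L : Type*} [Field K] [Field L] [Algebra K L] [CharZero L]
    {σ : L ≃ₐ[K] L} {x : L} (hx0 : x ≠ 0) (hσx : σ x = -x) (hσ : ∀ y, σ (σ y) = y)
    (hfix : ∀ y, σ y = y → ∃ a, algebraMap K L a = y) (y : L) :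
    ∃ a b : K, y = algebraMap K L a + algebraMap K L b * x := by
  obtain ⟨a, ha⟩ := hfix ((y + σ y) / 2) (by
    rw [map_div₀, map_add, hσ, map_ofNat, add_comm])
  obtain ⟨b, hb⟩ := hfix ((y - σ y) / (2 * x)) (by
    simp only [map_div₀, map_sub, map_mul, hσ, hσx, map_ofNat]
    rw [div_eq_div_iff (by simpa using hx0) (by simpa using hx0)]
    ring)
  refine ⟨a, b, ?_⟩
  rw [ha, hb]
  field_simp
  ring

lemma classNumber_odd_of_two_torsion {F : Type*} [Field F] [NumberField F]
    (h : ∀ c : ClassGroup (𝓞 F), c ^ 2 = 1 → c = 1) : Odd (classNumber F) := by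
  rw [← Nat.not_even_iff_odd, even_iff_two_dvd]
  intro h2
  have : Fact (Nat.Prime 2) := ⟨Nat.prime_two⟩
  obtain ⟨c, hc⟩ := exists_prime_orderOf_dvd_card 2 (G := ClassGroup (𝓞 F)) h2
  have := h c (by rw [← hc, pow_orderOf_eq_one])
  rw [this, orderOf_one] at hc
  omega

lemma pow_classNumber {F : Type*} [Field F] [NumberField F] (c : ClassGroup (𝓞 F)) :
    c ^ classNumber F = 1 :=
  pow_card_eq_one

variable {k : Type*} [Field k] [NumberField k] {p : ℕ} {β : k}

omit [NumberField k] in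
lemma isIntegral_of_sq_eq {x a b : k} (ha : IsIntegral ℤ a) (hb : IsIntegral ℤ b)
    (h : x ^ 2 = a * x + b) : IsIntegral ℤ x := by
  have hx : IsIntegral (𝓞 k) x := by
    obtain ⟨a', rfl⟩ : ∃ a' : 𝓞 k, algebraMap (𝓞 k) k a' = a := ⟨⟨a, ha⟩, rfl⟩
    obtain ⟨b', rfl⟩ : ∃ b' : 𝓞 k, algebraMap (𝓞 k) k b' = b := ⟨⟨b, hb⟩, rfl⟩
    refine ⟨Polynomial.X ^ 2 - (Polynomial.C a' * Polynomial.X + Polynomial.C b'),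
      ?_, ?_⟩
    · exact Polynomial.monic_X_pow_sub Polynomial.degree_linear_lt
    · simp only [Polynomial.eval₂_sub, Polynomial.eval₂_add, Polynomial.eval₂_mul,
        Polynomial.eval₂_C, Polynomial.eval₂_X, Polynomial.eval₂_X_pow]
      exact sub_eq_zero.mpr h
  exact isIntegral_trans (A := 𝓞 k) x hx

lemma conj_eq_self_of_sq_eq {z : ℂ} {r : ℝ} (hr : 0 ≤ r) (h : z ^ 2 = r) :
    starRingEnd ℂ z = z := by
  have h1 : z ^ 2 = ((√r : ℝ) : ℂ) ^ 2 := by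
    rw [h, ← Complex.ofReal_pow, Real.sq_sqrt hr]
  rcases sq_eq_sq_iff_eq_or_eq_neg.mp h1 with h2 | h2 <;> rw [h2] <;> simp

lemma rat_sq_ne_prime (hp : p.Prime) (y : ℚ) : y ^ 2 ≠ p := by
  intro h
  have h1 : (y : ℝ) ^ 2 = p := by exact_mod_cast h
  have h2 := hp.irrational_sqrt
  rw [← h1, Real.sqrt_sq_eq_abs] at h2
  exact h2 ⟨|y|, by simp⟩

lemma exists_conj_quadratic (hk : Module.finrank ℚ k = 2) (hp : p.Prime) (hβ : β ^ 2 = p) :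
    ∃ σ : k ≃ₐ[ℚ] k, σ β = -β ∧ (∀ y, σ (σ y) = y) ∧
      ∀ y, σ y = y → ∃ a, algebraMap ℚ k a = y := by
  refine exists_conj_of_sq_mem hk (d := p) (by simpa using hβ) ?_
  rintro y rfl
  apply rat_sq_ne_prime hp y
  apply (algebraMap ℚ k).injective
  simpa using hβ

lemma ne_zero_of_sq_eq_prime (hp : p.Prime) (hβ : β ^ 2 = p) : β ≠ 0 := by
  rintro rfl
  have : (p : k) ≠ 0 := by exact_mod_cast hp.ne_zero
  exact this (by simpa using hβ.symm)

lemma isReal_of_sq_eq_prime (hk : Module.finrank ℚ k = 2) (hp : p.Prime) (hβ : β ^ 2 = p)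
    (φ : k →+* ℂ) : ComplexEmbedding.IsReal φ := by
  obtain ⟨σ, h1, h2, h3⟩ := exists_conj_quadratic hk hp hβ
  refine RingHom.ext fun y => ?_
  obtain ⟨a, b, rfl⟩ := exists_eq_add_mul (ne_zero_of_sq_eq_prime hp hβ) h1 h2 h3 y
  have h4 : starRingEnd ℂ (φ β) = φ β :=
    conj_eq_self_of_sq_eq (r := p) (by positivity) (by rw [← map_pow, hβ]; simp)
  simp [ComplexEmbedding.conjugate_coe_eq, h4]

lemma card_infinitePlace_quadratic (hk : Module.finrank ℚ k = 2) (hp : p.Prime)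
    (hβ : β ^ 2 = p) : Fintype.card (InfinitePlace k) = 2 := by
  have h1 := InfinitePlace.card_add_two_mul_card_eq_rank k
  have h2 := InfinitePlace.card_eq_nrRealPlaces_add_nrComplexPlaces k
  have h3 : InfinitePlace.nrComplexPlaces k = 0 := by
    rw [nrComplexPlaces_eq_zero_iff]
    exact ⟨fun w => InfinitePlace.isReal_iff.mpr (isReal_of_sq_eq_prime hk hp hβ _)⟩
  omega

lemma rank_quadratic (hk : Module.finrank ℚ k = 2) (hp : p.Prime)
    (hβ : β ^ 2 = p) : Units.rank k = 1 := by
  rw [Units.rank, card_infinitePlace_quadratic hk hp hβ]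

lemma rank_rat : Units.rank ℚ = 0 := by
  have h1 := InfinitePlace.card_add_two_mul_card_eq_rank ℚ
  have h2 := InfinitePlace.card_eq_nrRealPlaces_add_nrComplexPlaces ℚ
  rw [Module.finrank_self] at h1
  rw [Units.rank]
  omega

instance finiteIndex_squares_units {F : Type*} [Field F] [NumberField F] :
    (squares (𝓞 F)ˣ).FiniteIndex :=
  ⟨by rw [index_squares_units]; positivity⟩

/-- The class number of a quadratic field of prime discriminant `p ≡ 1 (mod 4)` is odd. -/
theorem classNumber_odd_quadratic (hk : Module.finrank ℚ k = 2) (hp : p.Prime) (hp4 : p % 4 = 1)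
    (hβ : β ^ 2 = p) : Odd (classNumber k) := by
  obtain ⟨σ, hσβ, hσ, hfix⟩ := exists_conj_quadratic hk hp hβ
  have hβ0 := ne_zero_of_sq_eq_prime hp hβ
  obtain ⟨n, hn⟩ : ∃ n, p = 4 * n + 1 := ⟨p / 4, by omega⟩
  have hβint : IsIntegral ℤ β := isIntegral_of_sq_eq (a := 0) (b := (p : ℤ)) isIntegral_zero
    isIntegral_algebraMap (by simpa using hβ)
  have hlint : IsIntegral ℤ ((1 + β) / 2) :=
    isIntegral_of_sq_eq (a := 1) (b := (n : ℤ)) isIntegral_one isIntegral_algebraMap (by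
      rw [hn] at hβ
      push_cast at hβ ⊢
      linear_combination hβ / 4)
  set b : 𝓞 k := ⟨β, hβint⟩ with hb
  set l : 𝓞 k := ⟨(1 + β) / 2, hlint⟩ with hl
  have hτ := intConj_intConj hσ
  have hτb : intConj σ b = -b := RingOfIntegers.ext hσβ
  have hb0 : b ≠ 0 := by
    intro h
    exact hβ0 (congrArg (algebraMap (𝓞 k) k) h)
  apply classNumber_odd_of_two_torsion
  refine (ambiguous_class_bound (h := 1) (δ := -1) hτ (exists_of_intConj_eq hfix) ⟨b, ?_⟩
    odd_one ?_ ?_ ?_ hb0 hτb top_ne_bot ?_ ?_).1 rfl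
  · rw [hτb, Ne, neg_eq_iff_add_eq_zero, ← two_mul, mul_eq_zero]
    simpa using hb0
  · intro c
    rw [← Rat.classNumber_eq, pow_classNumber]
  · intro η x y hy h
    rcases Rat.RingOfIntegers.isUnit_iff.mp η.isUnit with h1 | h1
    · left
      exact ⟨1, Units.ext (RingOfIntegers.ext (by simpa using h1))⟩
    · right
      exact ⟨1, Units.ext (RingOfIntegers.ext (by simpa using h1))⟩
  · refine exists_norm_one_unit_ne_sq hτ (exists_of_intConj_eq hfix) ?_
    rw [index_squares_units, index_squares_units, rank_rat, rank_quadratic hk hp hβ]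
    norm_num
  · rw [Ideal.map_top]
  · intro P hP hP0 hram
    left
    have h1 := hram l
    have h2 : intConj σ l - l = -b := RingOfIntegers.ext (by
      change σ ((1 + β) / 2) - (1 + β) / 2 = -β
      rw [map_div₀, map_add, hσβ, map_one, map_ofNat]
      ring)
    rw [h2, neg_mem_iff] at h1
    have h3 : (Ideal.span {b}).IsPrime := isPrime_span_of_pow_finrank_eq hp (by
      rw [hk]
      exact RingOfIntegers.ext (hβ.trans (map_natCast (algebraMap (𝓞 k) k) p).symm))
    have h4 : (Ideal.span {b}).IsMaximal := h3.isMaximal (by simpa using hb0)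
    exact (h4.eq_of_le hP.ne_top ((Ideal.span_singleton_le_iff_mem _).mpr h1)).symm

end QuadraticField

section QuarticField

/-- Eisenstein's criterion for monic integral polynomials, over the rationals. -/
lemma irreducible_map_of_eisenstein {p : ℕ} (hp : p.Prime) {f : Polynomial ℤ} (hf : f.Monic)
    (hdeg : 0 < f.natDegree) (hdvd : ∀ n < f.natDegree, (p : ℤ) ∣ f.coeff n)
    (h0 : ¬ (p : ℤ) ^ 2 ∣ f.coeff 0) : Irreducible (f.map (algebraMap ℤ ℚ)) := by
  have hpp : Prime (p : ℤ) := Nat.prime_iff_prime_int.mp hp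
  have hspan : (Ideal.span {(p : ℤ)}).IsPrime :=
    (Ideal.span_singleton_prime hpp.ne_zero).mpr hpp
  refine (hf.irreducible_iff_irreducible_map_fraction_map (K := ℚ)).mp ?_
  refine Polynomial.IsEisensteinAt.irreducible (𝓟 := Ideal.span {(p : ℤ)}) ⟨?_, ?_, ?_⟩
    hspan hf.isPrimitive hdeg
  · rw [hf.leadingCoeff, ← Ideal.eq_top_iff_one]
    exact hspan.ne_top
  · intro n hn
    rw [Ideal.mem_span_singleton]
    exact hdvd n hn
  · rwa [Ideal.span_singleton_pow, Ideal.mem_span_singleton]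

lemma irreducible_X_pow_four_sub_prime {p : ℕ} (hp : p.Prime) :
    Irreducible (Polynomial.X ^ 4 - Polynomial.C (p : ℚ)) := by
  have hdeg : (Polynomial.X ^ 4 - Polynomial.C (p : ℤ)).natDegree = 4 :=
    Polynomial.natDegree_X_pow_sub_C
  have hpp : Prime (p : ℤ) := Nat.prime_iff_prime_int.mp hp
  have h := irreducible_map_of_eisenstein hp
    (Polynomial.monic_X_pow_sub_C (p : ℤ) (n := 4) (by norm_num)) (by rw [hdeg]; norm_num)
    (fun n hn => by
      rw [hdeg] at hn
      interval_cases n <;> simp [Polynomial.coeff_X_pow])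
    (fun h => by
      have h1 : (p : ℤ) ^ 2 ∣ (p : ℤ) ^ 1 := by simpa using h
      rw [pow_dvd_pow_iff hpp.ne_zero hpp.not_isUnit] at h1
      norm_num at h1)
  simpa using h

lemma minpoly_of_pow_four_eq_prime {K : Type*} [Field K] [CharZero K] {p : ℕ} (hp : p.Prime)
    {α : K} (hα : α ^ 4 = p) : minpoly ℚ α = Polynomial.X ^ 4 - Polynomial.C (p : ℚ) := by
  refine (minpoly.eq_of_irreducible_of_monic (irreducible_X_pow_four_sub_prime hp) ?_
    (Polynomial.monic_X_pow_sub_C _ (by norm_num))).symm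
  simp [hα]

lemma exists_embedding_of_pow_four_eq_prime {K : Type*} [Field K] [NumberField K] {p : ℕ}
    (hp : p.Prime) {α : K} (hα : α ^ 4 = p) {z : ℂ} (hz : z ^ 4 = p) :
    ∃ φ : K →+* ℂ, φ α = z := by
  have h1 := NumberField.Embeddings.range_eval_eq_rootSet_minpoly K ℂ α
  rw [minpoly_of_pow_four_eq_prime hp hα] at h1
  have h2 : z ∈ (Polynomial.X ^ 4 - Polynomial.C (p : ℚ)).rootSet ℂ := by
    rw [Polynomial.mem_rootSet]
    exact ⟨Polynomial.X_pow_sub_C_ne_zero (by norm_num) _, by simp [hz]⟩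
  rw [← h1] at h2
  exact h2

lemma mem_of_ramified_of_mem_ramified {k K : Type*} [Field k] [NumberField k] [Field K]
    [NumberField K] [Algebra k K] {s : 𝓞 k ≃ₐ[𝓞 ℚ] 𝓞 k}
    (hs : ∀ x, s (s x) = x) (hsfix : ∀ x, s x = x → ∃ a, algebraMap (𝓞 ℚ) (𝓞 k) a = x)
    {τ : 𝓞 K ≃ₐ[𝓞 k] 𝓞 K} (hτ : ∀ x, τ (τ x) = x)
    (hfix : ∀ x, τ x = x → ∃ a, algebraMap (𝓞 k) (𝓞 K) a = x)
    {l : 𝓞 k} (hl : l + s l = 1) {P P' : Ideal (𝓞 K)} [hP : P.IsPrime] [hP' : P'.IsPrime]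
    (h2 : (2 : 𝓞 K) ∈ P) (h2' : (2 : 𝓞 K) ∈ P')
    (hl1 : algebraMap (𝓞 k) (𝓞 K) l ∈ P) (hl2 : algebraMap (𝓞 k) (𝓞 K) l ∈ P')
    (hram : ∀ x, τ x - x ∈ P') {y : 𝓞 K} (hy : y ∈ P) : y ∈ P' := by
  obtain ⟨a, ha⟩ := hfix (y * τ y) (by rw [map_mul, hτ, mul_comm])
  obtain ⟨m₀, hm₀⟩ := hsfix (a * s l + s a * l) (by rw [map_add, map_mul, map_mul, hs, hs, add_comm])
  obtain ⟨m, rfl⟩ := Rat.ringOfIntegersEquiv.symm.surjective m₀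
  have hm : (m : 𝓞 K) = algebraMap (𝓞 k) (𝓞 K) (a * s l + s a * l) := by
    rw [← hm₀]
    simp
  have haP : algebraMap (𝓞 k) (𝓞 K) a ∈ P := ha ▸ P.mul_mem_right _ hy
  have hmP : (m : 𝓞 K) ∈ P := by
    rw [hm, map_add, map_mul, map_mul]
    exact P.add_mem (P.mul_mem_right _ haP) (P.mul_mem_left _ hl1)
  have hmP' : (m : 𝓞 K) ∈ P' := by
    rcases Int.even_or_odd' m with ⟨t, rfl | rfl⟩
    · push_cast
      exact P'.mul_mem_right _ h2'
    · exfalso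
      push_cast at hmP
      apply hP.ne_top
      rw [Ideal.eq_top_iff_one]
      exact (Ideal.add_mem_iff_right P (P.mul_mem_right _ h2)).mp hmP
  have h3 : algebraMap (𝓞 k) (𝓞 K) a * algebraMap (𝓞 k) (𝓞 K) (s l) ∈ P' := by
    rw [hm, map_add, map_mul, map_mul] at hmP'
    exact (Ideal.add_mem_iff_left P' (P'.mul_mem_left _ hl2)).mp hmP'
  rcases hP'.mem_or_mem h3 with h4 | h4
  · rw [ha] at h4
    rcases hP'.mem_or_mem h4 with h5 | h5
    · exact h5
    · have h6 := P'.sub_mem h5 (hram y)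
      rwa [sub_sub_cancel] at h6
  · exfalso
    apply hP'.ne_top
    rw [Ideal.eq_top_iff_one, ← map_one (algebraMap (𝓞 k) (𝓞 K)), ← hl, map_add]
    exact P'.add_mem hl2 h4

lemma map_eq_self_of_ramified {A B : Type*} [CommRing A] [CommRing B] [Algebra A B]
    {τ : B ≃ₐ[A] B} (hτ : ∀ x, τ (τ x) = x) {P : Ideal B} (hram : ∀ x, τ x - x ∈ P) :
    P.map τ = P := by
  have h1 : P.map τ ≤ P := by
    rw [Ideal.map_le_iff_le_comap]
    intro x hx
    have := P.add_mem (hram x) hx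
    rwa [sub_add_cancel] at this
  refine le_antisymm h1 fun x hx => ?_
  rw [← hτ x]
  exact Ideal.mem_map_of_mem τ (by
    have := P.add_mem (hram x) hx
    rwa [sub_add_cancel] at this)

variable {k K : Type*} [Field k] [NumberField k] [Field K] [NumberField K] [Algebra k K]
  {p : ℕ} {β : k} {α : K}

omit [NumberField K] in
lemma exists_conj_quartic (hk : Module.finrank ℚ k = 2) (hkK : Module.finrank k K = 2)
    (hp : p.Prime) (hβ : β ^ 2 = p) (hα : α ^ 2 = algebraMap k K β) :
    ∃ σ : K ≃ₐ[k] K, σ α = -α ∧ (∀ y, σ (σ y) = y) ∧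
      ∀ y, σ y = y → ∃ a, algebraMap k K a = y := by
  refine exists_conj_of_sq_mem hkK hα ?_
  rintro y rfl
  obtain ⟨s, hsβ, hs, hfix⟩ := exists_conj_quadratic hk hp hβ
  have hy : y ^ 2 = β := (algebraMap k K).injective (by rw [map_pow, hα])
  obtain ⟨a, ha⟩ := hfix (y * s y) (by rw [map_mul, hs, mul_comm])
  have h1 : algebraMap ℚ k (a ^ 2) = algebraMap ℚ k (-p) := by
    rw [map_pow, ha, mul_pow, ← map_pow, hy, hsβ, map_neg, map_natCast, ← hβ]
    ring
  have h2 := (algebraMap ℚ k).injective h1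
  have h3 : (0 : ℚ) < p := by exact_mod_cast hp.pos
  nlinarith [sq_nonneg a]

omit [NumberField k] [NumberField K] in
lemma pow_four_eq_prime (hβ : β ^ 2 = p) (hα : α ^ 2 = algebraMap k K β) : α ^ 4 = p := by
  rw [show α ^ 4 = (α ^ 2) ^ 2 by ring, hα, ← map_pow, hβ, map_natCast]

omit [NumberField K] in
lemma quartic_ne_zero (hp : p.Prime) (hβ : β ^ 2 = p) (hα : α ^ 2 = algebraMap k K β) :
    α ≠ 0 := by
  rintro rfl
  apply ne_zero_of_sq_eq_prime hp hβ
  simpa using hα.symm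

lemma exists_real_pow_four (p : ℕ) : ∃ r : ℝ, r ^ 4 = p := by
  refine ⟨√√p, ?_⟩
  rw [show (√√(p : ℝ)) ^ 4 = ((√√p) ^ 2) ^ 2 by ring, Real.sq_sqrt (by positivity),
    Real.sq_sqrt (by positivity)]

lemma finrank_quartic (hk : Module.finrank ℚ k = 2) (hkK : Module.finrank k K = 2) :
    Module.finrank ℚ K = 4 := by
  rw [← Module.finrank_mul_finrank ℚ k K, hk, hkK]

lemma two_le_rank_quartic (hk : Module.finrank ℚ k = 2) (hkK : Module.finrank k K = 2)
    (hp : p.Prime) (hβ : β ^ 2 = p) (hα : α ^ 2 = algebraMap k K β) :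
    2 ≤ Units.rank K := by
  obtain ⟨r, hr⟩ := exists_real_pow_four p
  obtain ⟨φ, hφ⟩ := exists_embedding_of_pow_four_eq_prime hp (pow_four_eq_prime hβ hα)
    (z := r) (by exact_mod_cast hr)
  obtain ⟨σ, h1, h2, h3⟩ := exists_conj_quartic hk hkK hp hβ hα
  have hreal : ComplexEmbedding.IsReal φ := by
    refine RingHom.ext fun y => ?_
    obtain ⟨a, b, rfl⟩ := exists_eq_add_mul (quartic_ne_zero hp hβ hα) h1 h2 h3 y
    have h4 := isReal_of_sq_eq_prime hk hp hβ (φ.comp (algebraMap k K))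
    have ha := RingHom.congr_fun h4 a
    have hb := RingHom.congr_fun h4 b
    rw [ComplexEmbedding.conjugate_coe_eq] at ha hb ⊢
    simp only [RingHom.comp_apply] at ha hb
    rw [map_add, map_mul, map_add, map_mul, ha, hb, hφ, Complex.conj_ofReal]
  have h5 : 0 < InfinitePlace.nrRealPlaces K := by
    classical
    rw [InfinitePlace.nrRealPlaces, Fintype.card_pos_iff]
    exact ⟨⟨InfinitePlace.mk φ, InfinitePlace.isReal_iff.mpr (by
      rwa [InfinitePlace.embedding_mk_eq_of_isReal hreal])⟩⟩
  have h6 := InfinitePlace.card_add_two_mul_card_eq_rank K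
  have h7 := InfinitePlace.card_eq_nrRealPlaces_add_nrComplexPlaces K
  rw [finrank_quartic hk hkK] at h6
  rw [Units.rank]
  omega

lemma mul_conj_ne_neg (hk : Module.finrank ℚ k = 2)
    (hp : p.Prime) (hβ : β ^ 2 = p) (hα : α ^ 2 = algebraMap k K β)
    {σ : K ≃ₐ[k] K} (hσα : σ α = -α) (hσ : ∀ y, σ (σ y) = y)
    (hfix : ∀ y, σ y = y → ∃ a, algebraMap k K a = y) {x y : K} (hy : y ≠ 0) :
    x * σ x ≠ -(y * σ y) := by
  intro h
  obtain ⟨r, hr⟩ := exists_real_pow_four p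
  obtain ⟨φ, hφ⟩ := exists_embedding_of_pow_four_eq_prime hp (pow_four_eq_prime hβ hα)
    (z := r * Complex.I) (by
      rw [mul_pow, Complex.I_pow_four, mul_one]
      exact_mod_cast hr)
  have hconj : ∀ y, φ (σ y) = starRingEnd ℂ (φ y) := by
    intro y
    obtain ⟨a, b, rfl⟩ := exists_eq_add_mul (quartic_ne_zero hp hβ hα) hσα hσ hfix y
    have h4 := isReal_of_sq_eq_prime hk hp hβ (φ.comp (algebraMap k K))
    have ha := RingHom.congr_fun h4 a
    have hb := RingHom.congr_fun h4 b
    rw [ComplexEmbedding.conjugate_coe_eq] at ha hb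
    simp only [RingHom.comp_apply] at ha hb
    simp only [map_add, map_mul, AlgEquiv.commutes, hσα, map_neg, ha, hb, hφ, Complex.conj_ofReal,
      Complex.conj_I]
    ring
  have h1 := congrArg φ h
  rw [map_mul, map_neg, map_mul, hconj, hconj, Complex.mul_conj, Complex.mul_conj] at h1
  have h2 : Complex.normSq (φ x) = -Complex.normSq (φ y) := by exact_mod_cast h1
  have h3 : 0 < Complex.normSq (φ y) := Complex.normSq_pos.mpr ((map_ne_zero φ).mpr hy)
  have h4 := Complex.normSq_nonneg (φ x)
  linarith

/-- The field `ℚ(p^{1/4})`, `p ≡ 1 (mod 8)`, has at most one ideal class of order two. -/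
theorem eq_of_two_torsion_quartic (hk : Module.finrank ℚ k = 2) (hkK : Module.finrank k K = 2)
    (hp : p.Prime) (hp8 : p % 8 = 1) (hβ : β ^ 2 = p) (hα : α ^ 2 = algebraMap k K β)
    {c c' : ClassGroup (𝓞 K)} (hc : c ^ 2 = 1) (hc' : c' ^ 2 = 1) (h1 : c ≠ 1) (h1' : c' ≠ 1) :
    c = c' := by
  obtain ⟨σ, hσα, hσ, hfix⟩ := exists_conj_quartic hk hkK hp hβ hα
  obtain ⟨s, hsβ, hs, hsfix⟩ := exists_conj_quadratic hk hp hβ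
  have hα0 := quartic_ne_zero hp hβ hα
  obtain ⟨n, hn⟩ : ∃ n, p = 8 * n + 1 := ⟨p / 8, by omega⟩
  have hlint : IsIntegral ℤ ((1 + β) / 2) :=
    isIntegral_of_sq_eq (a := 1) (b := (2 * n : ℤ)) isIntegral_one isIntegral_algebraMap (by
      rw [hn] at hβ
      push_cast at hβ ⊢
      linear_combination hβ / 4)
  have hαint : IsIntegral ℤ α := by
    refine IsIntegral.of_pow (n := 4) (by norm_num) ?_
    rw [pow_four_eq_prime hβ hα]
    simpa using isIntegral_algebraMap (R := ℤ) (A := K) (x := (p : ℤ))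
  set l : 𝓞 k := ⟨(1 + β) / 2, hlint⟩ with hl
  set a : 𝓞 K := ⟨α, hαint⟩ with ha
  have hxint : IsIntegral ℤ (algebraMap k K ((1 + β) / 2) * (1 + α) / 2) := by
    have h2 : IsIntegral ℤ (algebraMap k K ((1 + β) / 2)) := hlint.algebraMap
    refine isIntegral_of_sq_eq h2
      (h2.mul (isIntegral_algebraMap (R := ℤ) (x := n))) ?_
    have hβK : algebraMap k K β ^ 2 = 8 * n + 1 := by
      rw [← map_pow, hβ, map_natCast, hn]
      simp
    simp only [map_div₀, map_add, map_one, map_ofNat]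
    rw [← hα] at hβK ⊢
    simp only [eq_intCast, Int.cast_natCast]
    linear_combination (1 + α ^ 2) / 16 * hβK
  set x : 𝓞 K := ⟨_, hxint⟩ with hx
  have hτ := intConj_intConj hσ
  have hτfix := exists_of_intConj_eq hfix
  have hτa : intConj σ a = -a := RingOfIntegers.ext hσα
  have ha0 : a ≠ 0 := by
    intro h
    exact hα0 (congrArg (algebraMap (𝓞 K) K) h)
  have h2a : intConj σ a - a = -(2 * a) := by
    rw [hτa]
    ring
  have hτx : intConj σ x - x = -(algebraMap (𝓞 k) (𝓞 K) l * a) := RingOfIntegers.ext (by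
    change σ (algebraMap k K ((1 + β) / 2) * (1 + α) / 2) -
      algebraMap k K ((1 + β) / 2) * (1 + α) / 2 = -(algebraMap k K ((1 + β) / 2) * α)
    simp only [map_div₀, map_mul, AlgEquiv.commutes, map_add, map_one, hσα, map_ofNat]
    ring)
  have hls : l + intConj s l = 1 := RingOfIntegers.ext (by
    change (1 + β) / 2 + s ((1 + β) / 2) = 1
    simp only [map_div₀, map_add, map_one, hsβ, map_ofNat]
    ring)
  have hmax : (Ideal.span {a}).IsMaximal := by
    have h3 : (Ideal.span {a}).IsPrime := isPrime_span_of_pow_finrank_eq hp (by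
      rw [finrank_quartic hk hkK]
      exact RingOfIntegers.ext ((pow_four_eq_prime hβ hα).trans
        (map_natCast (algebraMap (𝓞 K) K) p).symm))
    exact h3.isMaximal (by simpa using ha0)
  have hram : ∀ P : Ideal (𝓞 K), P.IsPrime → (∀ y, intConj σ y - y ∈ P) →
      P = Ideal.span {a} ∨ (2 ∈ P ∧ algebraMap (𝓞 k) (𝓞 K) l ∈ P) := by
    intro P hP hPr
    by_cases haP : a ∈ P
    · left
      exact (hmax.eq_of_le hP.ne_top ((Ideal.span_singleton_le_iff_mem _).mpr haP)).symm
    · right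
      have h3 := hPr a
      have h4 := hPr x
      rw [h2a, neg_mem_iff] at h3
      rw [hτx, neg_mem_iff] at h4
      exact ⟨(hP.mem_or_mem h3).resolve_right haP, (hP.mem_or_mem h4).resolve_right haP⟩
  obtain ⟨Q, hQ0, hQ, hQram⟩ : ∃ Q : Ideal (𝓞 K), Q ≠ ⊥ ∧ Q.map (intConj σ) = Q ∧
      ∀ P : Ideal (𝓞 K), P.IsPrime → P ≠ ⊥ → (∀ y, intConj σ y - y ∈ P) →
        P = Ideal.span {a} ∨ P = Q := by
    by_cases hex : ∃ Q : Ideal (𝓞 K), Q.IsPrime ∧ Q ≠ ⊥ ∧ (∀ y, intConj σ y - y ∈ Q) ∧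
        Q ≠ Ideal.span {a}
    · obtain ⟨Q, hQ, hQ0, hQr, hQa⟩ := hex
      refine ⟨Q, hQ0, map_eq_self_of_ramified hτ hQr, fun P hP hP0 hPr => ?_⟩
      rcases hram P hP hPr with h3 | ⟨h3, h4⟩
      · exact Or.inl h3
      · right
        obtain ⟨h5, h6⟩ := (hram Q hQ hQr).resolve_left hQa
        exact (hP.isMaximal hP0).eq_of_le hQ.ne_top fun y hy =>
          mem_of_ramified_of_mem_ramified (intConj_intConj hs) (exists_of_intConj_eq hsfix) hτ
            hτfix hls h3 h5 h4 h6 hQr hy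
    · push Not at hex
      exact ⟨⊤, top_ne_bot, Ideal.map_top _, fun P hP hP0 hPr => Or.inl (hex P hP hP0 hPr)⟩
  obtain ⟨δ, hδ⟩ := exists_unit_of_neg_one_not_norm (τ := intConj σ) (by
      rw [index_squares_units, rank_quadratic hk hp hβ]
      norm_num) (fun y z hz h =>
      mul_conj_ne_neg hk hp hβ hα hσα hσ hfix (x := y) (y := z)
        (by simpa using hz) (congrArg (algebraMap (𝓞 K) K) h))
  refine (ambiguous_class_bound hτ hτfix ⟨a, ?_⟩
    (classNumber_odd_quadratic hk hp (by omega) hβ) pow_classNumber δ hδ ?_ ha0 hτa hQ0 hQ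
    hQram).2 c c' hc hc' h1 h1'
  · rw [hτa, Ne, neg_eq_iff_add_eq_zero, ← two_mul, mul_eq_zero]
    simpa using ha0
  · refine exists_norm_one_unit_ne_sq hτ hτfix ?_
    rw [index_squares_units, index_squares_units, rank_quadratic hk hp hβ]
    exact Nat.pow_lt_pow_right (by norm_num)
      (by have := two_le_rank_quartic hk hkK hp hβ hα; omega)

end QuarticField

section UnramifiedQuadratic

lemma card_mod_four_eq_two {G : Type*} [CommGroup G] [Fintype G] {h : ℕ} (hh : Odd h)
    (hexp : ∀ c : G, c ^ (2 * h) = 1) (heven : Even (Fintype.card G))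
    (hinv : ∀ c c' : G, c ^ 2 = 1 → c' ^ 2 = 1 → c ≠ 1 → c' ≠ 1 → c = c') :
    Fintype.card G % 4 = 2 := by
  by_contra hcon
  have h4 : 2 ^ 2 ∣ Nat.card G := by
    rw [Nat.card_eq_fintype_card]
    obtain ⟨m, hm⟩ := heven
    omega
  have : Fact (Nat.Prime 2) := ⟨Nat.prime_two⟩
  obtain ⟨H, hH⟩ := Sylow.exists_subgroup_card_pow_prime 2 h4
  have hsq : ∀ x : H, (x : G) ^ 2 = 1 := by
    intro x
    rw [← orderOf_dvd_iff_pow_eq_one]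
    have h1 : orderOf (x : G) ∣ 2 * 2 := by
      rw [orderOf_dvd_iff_pow_eq_one]
      have := congrArg Subtype.val (pow_card_eq_one' (x := x))
      rw [hH] at this
      simpa using this
    have h2 : orderOf (x : G) ∣ 2 * h := orderOf_dvd_iff_pow_eq_one.mpr (hexp x)
    have h3 := Nat.dvd_gcd h1 h2
    rwa [Nat.gcd_mul_left, (Nat.coprime_two_left.mpr hh), mul_one] at h3
  classical
  have hinj : Function.Injective fun x : H => decide (x = 1) := by
    intro x y hxy
    simp only [decide_eq_decide] at hxy
    by_cases hx : x = 1
    · rw [hx, hxy.mp hx]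
    · have hy : y ≠ 1 := fun hy => hx (hxy.mpr hy)
      exact Subtype.ext (hinv x y (hsq x) (hsq y) (by simpa using hx) (by simpa using hy))
  have := Nat.card_le_card_of_injective _ hinj
  rw [hH] at this
  simp at this

lemma pow_two_mul_classNumber {K M : Type*} [Field K] [NumberField K] [Field M] [NumberField M]
    [Algebra K M] (hKM : Module.finrank K M = 2) (c : ClassGroup (𝓞 K)) :
    c ^ (2 * classNumber M) = 1 := by
  obtain ⟨⟨I, hI⟩, rfl⟩ := ClassGroup.mk0_surjective c
  have hI0 := nonZeroDivisors.ne_zero hI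
  set J : Ideal (𝓞 M) := I.map (algebraMap (𝓞 K) (𝓞 M)) with hJ
  have hJ0 : J ≠ ⊥ := by
    rwa [hJ, Ne, Ideal.map_eq_bot_iff_of_injective (FaithfulSMul.algebraMap_injective _ _)]
  have h1 := pow_classNumber (ClassGroup.mk0 ⟨J, mem_nonZeroDivisors_of_ne_zero hJ0⟩)
  rw [← map_pow, SubmonoidClass.mk_pow, ClassGroup.mk0_eq_one_iff] at h1
  obtain ⟨b, hb⟩ := h1
  have h2 : Module.finrank (𝓞 K) (𝓞 M) = 2 := by
    rw [← hKM, IsFractionRing.finrank_eq (𝓞 K) K (𝓞 M) M]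
  rw [← map_pow, SubmonoidClass.mk_pow, ClassGroup.mk0_eq_one_iff]
  refine ⟨⟨Algebra.intNorm (𝓞 K) (𝓞 M) b, ?_⟩⟩
  have h3 := congrArg (Ideal.relNorm (𝓞 K)) hb
  rw [map_pow, hJ, Ideal.relNorm_algebraMap, h2, ← pow_mul] at h3
  rw [h3]
  exact Ideal.relNorm_singleton _ b

variable {k K M : Type*} [Field k] [NumberField k] [Field K] [NumberField K] [Algebra k K]
  [Field M] [NumberField M] [Algebra K M] {p : ℕ} {β : k} {α : K} {c d : ℤ} {u v : M}

omit [NumberField M] in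
lemma algebraMap_ne_of_sq_eq (hk : Module.finrank ℚ k = 2) (hkK : Module.finrank k K = 2)
    (hp : p.Prime) (hβ : β ^ 2 = p) (hα : α ^ 2 = algebraMap k K β) (hd : d ≠ 0)
    (hcd : (p : ℤ) = c ^ 2 + 4 * d ^ 2)
    (hu : 2 * u ^ 2 = p + c * algebraMap K M α ^ 2) (y : K) : algebraMap K M y ≠ u := by
  rintro rfl
  obtain ⟨σ, hσα, hσ, hfix⟩ := exists_conj_quartic hk hkK hp hβ hα
  obtain ⟨s, hsβ, hs, hsfix⟩ := exists_conj_quadratic hk hp hβ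
  have hα0 := quartic_ne_zero hp hβ hα
  have hcd' : (p : ℚ) = c ^ 2 + 4 * d ^ 2 := by exact_mod_cast hcd
  have hcdk : (p : k) = c ^ 2 + 4 * d ^ 2 := by exact_mod_cast hcd
  have hd' : (d : ℚ) ≠ 0 := by exact_mod_cast hd
  have hy : 2 * y ^ 2 = algebraMap k K (p + c * β) := by
    apply (algebraMap K M).injective
    simp only [map_mul, map_pow, map_ofNat, hu, map_add, map_natCast, map_intCast, ← hα]
  have hσy : σ y ^ 2 = y ^ 2 := by
    have h1 := congrArg σ hy
    rw [AlgEquiv.commutes, map_mul, map_pow, map_ofNat, ← hy] at h1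
    exact mul_left_cancel₀ two_ne_zero h1
  rcases sq_eq_sq_iff_eq_or_eq_neg.mp hσy with h | h
  · obtain ⟨z, rfl⟩ := hfix y h
    have hz : 2 * z ^ 2 = p + c * β := (algebraMap k K).injective (by
      rw [← hy, map_mul, map_pow, map_ofNat])
    obtain ⟨q, hq⟩ := hsfix (z * s z) (by rw [map_mul, hs, mul_comm])
    have hsz : 2 * s z ^ 2 = p - c * β := by
      have h1 := congrArg s hz
      simpa [hsβ, sub_eq_add_neg, map_ofNat s 2] using h1
    have h2 : algebraMap ℚ k (q ^ 2) = algebraMap ℚ k (p * d ^ 2) := by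
      simp only [map_pow, hq, map_mul, map_natCast, map_intCast]
      linear_combination (1 / 2 * z ^ 2) * hsz + (p - c * β) / 4 * hz - c ^ 2 / 4 * hβ +
        (p : k) / 4 * hcdk
    have h3 := (algebraMap ℚ k).injective h2
    apply rat_sq_ne_prime hp (q / d)
    rw [div_pow, h3]
    field_simp
  · obtain ⟨z, hz⟩ := hfix (y / α) (by rw [map_div₀, h, hσα, neg_div_neg_eq])
    rw [eq_div_iff hα0] at hz
    have hz : 2 * (z ^ 2 * β) = p + c * β := (algebraMap k K).injective (by
      rw [← hy, ← hz]
      simp only [map_mul, map_pow, map_ofNat, ← hα]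
      ring)
    obtain ⟨q, hq⟩ := hsfix (z * s z) (by rw [map_mul, hs, mul_comm])
    have hsz : -2 * (s z ^ 2 * β) = p - c * β := by
      have h1 := congrArg s hz
      simpa [hsβ, sub_eq_add_neg, map_ofNat s 2] using h1
    have hp0 : (p : k) ≠ 0 := by exact_mod_cast hp.ne_zero
    have h2 : algebraMap ℚ k (q ^ 2) = algebraMap ℚ k (-d ^ 2) := by
      simp only [map_pow, hq, map_neg, map_intCast]
      apply mul_left_cancel₀ hp0
      rw [← hβ]
      linear_combination (-1 / 2 * (z ^ 2 * β)) * hsz - (p - c * β) / 4 * hz + c ^ 2 / 4 * hβ -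
        (p : k) / 4 * hcdk + d ^ 2 * hβ
    have h3 := (algebraMap ℚ k).injective h2
    have h4 : (0 : ℚ) < d ^ 2 := by positivity
    nlinarith [sq_nonneg q]

omit [NumberField k] [NumberField K] in
lemma isUnramifiedAtInfinitePlaces_of_sq_eq (hβ : β ^ 2 = p) (hα : α ^ 2 = algebraMap k K β)
    (hcd : (p : ℤ) = c ^ 2 + 4 * d ^ 2)
    (hu : 2 * u ^ 2 = p + c * algebraMap K M α ^ 2)
    (hspan : ∀ y : M, ∃ a b : K, y = algebraMap K M a + algebraMap K M b * u) :
    IsUnramifiedAtInfinitePlaces K M := by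
  refine ⟨fun w => InfinitePlace.isUnramified_iff.mpr ?_⟩
  rw [← InfinitePlace.not_isReal_iff_isComplex, or_iff_not_imp_right, not_not]
  intro hreal
  have h1 := InfinitePlace.comap_embedding_of_isReal _ hreal
  have h2 := InfinitePlace.isReal_iff.mp hreal
  rw [h1] at h2
  rw [InfinitePlace.isReal_iff]
  set φ := w.embedding
  have h3 : ∀ a, starRingEnd ℂ (φ (algebraMap K M a)) = φ (algebraMap K M a) :=
    RingHom.congr_fun h2
  obtain ⟨r, hr⟩ := Complex.conj_eq_iff_real.mp (h3 α)
  have hr4 : r ^ 4 = p := by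
    have h4 := congrArg (fun x => φ (algebraMap K M x)) (pow_four_eq_prime hβ hα)
    simp only [map_pow, map_natCast, hr] at h4
    exact_mod_cast h4
  have hu' : φ u ^ 2 = (((p + c * r ^ 2) / 2 : ℝ) : ℂ) := by
    have h4 := congrArg φ hu
    simp only [map_mul, map_pow, map_ofNat, map_add, map_natCast, map_intCast, hr] at h4
    push_cast
    linear_combination h4 / 2
  have h5 : (0 : ℝ) ≤ (p + c * r ^ 2) / 2 := by
    have h6 : |(c : ℝ) * r ^ 2| ≤ p := by
      apply abs_le_of_sq_le_sq _ (by positivity)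
      have hcdr : (p : ℝ) = c ^ 2 + 4 * d ^ 2 := by exact_mod_cast hcd
      rw [mul_pow, show (r ^ 2) ^ 2 = r ^ 4 by ring, hr4, sq (p : ℝ)]
      exact mul_le_mul_of_nonneg_right (by rw [hcdr]; nlinarith [sq_nonneg (d : ℝ)])
        (by positivity)
    have := (abs_le.mp h6).1
    linarith
  have h6 := conj_eq_self_of_sq_eq h5 hu'
  refine RingHom.ext fun y => ?_
  obtain ⟨a, b, rfl⟩ := hspan y
  rw [ComplexEmbedding.conjugate_coe_eq]
  simp only [map_add, map_mul, h3, h6]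

lemma isIntegral_add_intCast_div_two {F : Type*} [Field F] [CharZero F] {b : F}
    (hb : IsIntegral ℤ ((1 + b) / 2)) (hc : Odd c) : IsIntegral ℤ ((b + c) / 2) := by
  obtain ⟨j, rfl⟩ := hc
  have h1 := hb.add (isIntegral_algebraMap (R := ℤ) (A := F) (x := j))
  rw [show (b + ((2 * j + 1 : ℤ) : F)) / 2 = (1 + b) / 2 + algebraMap ℤ F j by
    rw [eq_intCast]
    push_cast
    ring]
  exact h1

omit [NumberField K] in
lemma mem_of_ramified {b u : M} {n t m e : ℤ} (he : e = 1 ∨ e = -1) (hb : b ^ 2 = 8 * n + 1)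
    (hc : c = 4 * t + e) (hn : n = t + 2 * m) (hu : 2 * u ^ 2 = b ^ 2 + c * b)
    {τ : M ≃ₐ[K] M} (hτu : τ u = -u) (hτb : τ b = b) (hbint : IsIntegral ℤ ((1 + b) / 2))
    {P : Ideal (𝓞 M)} (hP : ∀ x, intConj τ x - x ∈ P) {u' : 𝓞 M} (hu' : (u' : M) = u) :
    u' ∈ P := by
  have hint : IsIntegral ℤ ((2 * u + b + e) / 4) := by
    have he' : IsIntegral ℤ ((b + e) / 2) := isIntegral_add_intCast_div_two hbint (by
      rcases he with rfl | rfl <;> decide)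
    refine isIntegral_of_sq_eq he' ((hbint.mul (isIntegral_algebraMap (R := ℤ) (x := t))).add
      (isIntegral_algebraMap (R := ℤ) (x := m))) ?_
    have heM : (e : M) ^ 2 = 1 := by
      rcases he with rfl | rfl <;> simp
    simp only [eq_intCast]
    subst hc hn
    push_cast at hu hb ⊢
    linear_combination hu / 8 + hb / 16 - heM / 16
  have h1 := hP ⟨_, hint⟩
  have h2 : intConj τ ⟨_, hint⟩ - ⟨_, hint⟩ = -u' := RingOfIntegers.ext (by
    change τ ((2 * u + b + e) / 4) - (2 * u + b + e) / 4 = -(u' : M)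
    simp only [map_div₀, map_add, map_mul, hτu, hτb, map_ofNat, map_intCast, hu']
    ring)
  rwa [h2, neg_mem_iff] at h1

lemma exists_congruence_of_eq_sq_add_four_mul_sq (hp8 : p % 8 = 1)
    (hcd : (p : ℤ) = c ^ 2 + 4 * d ^ 2) :
    ∃ e t n m : ℤ, (e = 1 ∨ e = -1) ∧ (p : ℤ) = 8 * n + 1 ∧ c = 4 * t + e ∧ n = t + 2 * m := by
  obtain ⟨n, hn⟩ : ∃ n : ℤ, (p : ℤ) = 8 * n + 1 := ⟨p / 8, by omega⟩
  rw [hn] at hcd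
  obtain ⟨j, rfl⟩ : Odd c := by
    rw [← Int.not_even_iff_odd]
    rintro ⟨j, rfl⟩
    ring_nf at hcd
    omega
  obtain ⟨d', rfl⟩ : Even d := by
    rw [← Int.not_odd_iff_even]
    rintro ⟨d', rfl⟩
    obtain ⟨i, hi⟩ := Int.even_mul_succ_self j
    have : 8 * n = 4 * (i + i) + 4 * (2 * d' + 1) ^ 2 := by
      rw [← hi]
      linear_combination hcd
    ring_nf at this
    omega
  rcases Int.even_or_odd' j with ⟨t, rfl | rfl⟩
  · refine ⟨1, t, n, t ^ 2 + d' ^ 2, Or.inl rfl, hn, by ring, ?_⟩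
    linarith
  · refine ⟨-1, t + 1, n, (t + 1) ^ 2 - (t + 1) + d' ^ 2, Or.inr rfl, hn, by ring, ?_⟩
    linarith

/-- If a suitable quadratic extension `M` of `ℚ(p^{1/4})`, unramified everywhere, has odd class
number, then the class number of `ℚ(p^{1/4})` is `2` modulo `4`. -/
theorem classNumber_quartic_mod_four (hk : Module.finrank ℚ k = 2)
    (hkK : Module.finrank k K = 2) (hKM : Module.finrank K M = 2) (hp : p.Prime)
    (hp8 : p % 8 = 1) (hβ : β ^ 2 = p) (hα : α ^ 2 = algebraMap k K β)
    (hcd : (p : ℤ) = c ^ 2 + 4 * d ^ 2) (hu : 2 * u ^ 2 = p + c * algebraMap K M α ^ 2)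
    (hodd : Odd (classNumber M)) : classNumber K % 4 = 2 := by
  have hd : d ≠ 0 := by
    rintro rfl
    apply rat_sq_ne_prime hp c
    have : (p : ℚ) = c ^ 2 + 4 * 0 ^ 2 := by exact_mod_cast hcd
    rw [this]
    ring
  have huK := algebraMap_ne_of_sq_eq hk hkK hp hβ hα hd hcd hu
  obtain ⟨τ, hτu, hτ, hfix⟩ := exists_conj_of_sq_mem hKM (x := u) (d := (p + c * α ^ 2) / 2) (by
    simp only [map_div₀, map_add, map_natCast, map_mul, map_intCast, map_pow, map_ofNat]
    rw [← hu]
    ring) huK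
  have hu0 : u ≠ 0 := fun h => huK 0 (by rw [map_zero, h])
  have hspan := exists_eq_add_mul hu0 hτu hτ hfix
  have : Algebra.IsQuadraticExtension K M := ⟨hKM⟩
  have : IsUnramifiedAtInfinitePlaces K M :=
    isUnramifiedAtInfinitePlaces_of_sq_eq hβ hα hcd hu hspan
  have hrank : Units.rank M + 1 = 2 * (Units.rank K + 1) := by
    have h1 := IsUnramifiedAtInfinitePlaces.card_infinitePlace (k := K) (K := M)
    rw [hKM] at h1
    have h2 : 0 < Fintype.card (InfinitePlace K) := Fintype.card_pos
    rw [Units.rank, Units.rank, h1]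
    omega
  have hτ' := intConj_intConj hτ
  have hfix' := exists_of_intConj_eq hfix
  obtain ⟨w, hw, hw'⟩ := exists_norm_one_unit_ne_div hτ' hfix' (by
    rw [index_squares_units, index_squares_units, hrank, ← pow_mul,
      mul_comm (Units.rank K + 1)]
    exact lt_mul_left (by positivity) one_lt_two)
  obtain ⟨e, t, n, m, he, hn, hc, hnt⟩ := exists_congruence_of_eq_sq_add_four_mul_sq hp8 hcd
  set b : M := algebraMap K M α ^ 2 with hb
  have hb2 : b ^ 2 = p := by
    rw [hb, ← pow_mul, ← map_pow, pow_four_eq_prime hβ hα, map_natCast]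
  have hnM : (p : M) = 8 * n + 1 := by exact_mod_cast hn
  have hb0 : b ≠ 0 := ne_zero_of_sq_eq_prime hp hb2
  have ha0 : algebraMap K M α ≠ 0 := fun h => hb0 (by rw [hb, h]; simp)
  have hbint : IsIntegral ℤ ((1 + b) / 2) :=
    isIntegral_of_sq_eq (a := 1) (b := (2 * n : ℤ)) isIntegral_one
      (by simpa using isIntegral_algebraMap (R := ℤ) (A := M) (x := 2 * n)) (by
        push_cast
        linear_combination hb2 / 4 + hnM / 4)
  have hcodd : Odd c := by
    rw [hc]
    rcases he with rfl | rfl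
    · exact ⟨2 * t, by ring⟩
    · exact ⟨2 * t - 1, by ring⟩
  have hb1 : IsIntegral ℤ b := by
    have := (hbint.add hbint).sub isIntegral_one
    rwa [show (1 + b) / 2 + (1 + b) / 2 - 1 = b by ring] at this
  have ha1 : IsIntegral ℤ (algebraMap K M α) := by
    refine IsIntegral.of_pow (n := 2) two_pos hb1
  have hwint : IsIntegral ℤ (u / algebraMap K M α) := by
    refine IsIntegral.of_pow (n := 2) two_pos ?_
    convert isIntegral_add_intCast_div_two hbint hcodd using 1
    rw [div_pow, ← hb, div_eq_div_iff hb0 two_ne_zero]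
    linear_combination hu - hb2
  have huint : IsIntegral ℤ u := by
    have := ha1.mul hwint
    rwa [mul_div_cancel₀ _ ha0] at this
  set v : M := d * b / u with hv
  have huv : u * v = d * b := by
    rw [hv]
    field_simp
  have hcdM : (p : M) = c ^ 2 + 4 * d ^ 2 := by exact_mod_cast hcd
  have hv2 : 2 * v ^ 2 = p - c * b := by
    apply mul_left_cancel₀ (mul_ne_zero two_ne_zero (pow_ne_zero 2 hu0))
    linear_combination 4 * (u * v + d * b) * huv - (p - c * b) * hu + (c ^ 2 + 4 * d ^ 2) * hb2 -
      (p : M) * hcdM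
  have huv2 : u ^ 2 + v ^ 2 = p := by linear_combination hu / 2 + hv2 / 2
  have hvint : IsIntegral ℤ v := by
    refine IsIntegral.of_pow (n := 2) two_pos ?_
    rw [← eq_sub_iff_add_eq'] at huv2
    rw [huv2]
    have h1 := isIntegral_algebraMap (R := ℤ) (A := M) (x := (p : ℤ))
    rw [eq_intCast, Int.cast_natCast] at h1
    exact h1.sub (huint.pow 2)
  have hτb : τ b = b := by rw [hb, map_pow, AlgEquiv.commutes]
  have hτv : τ v = -v := by
    rw [hv, map_div₀, map_mul, hτb, hτu, map_intCast, div_neg]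
  have heven : ¬ Odd (classNumber K) := by
    refine not_odd_of_unramified_of_unit hτ' hfix' ⟨⟨u, huint⟩, fun h => ?_⟩ pow_classNumber
      (fun P hP hP0 hram => ?_) w hw hw'
    · have h1 : τ u = u := congrArg (algebraMap (𝓞 M) M) h
      rw [hτu, neg_eq_iff_add_eq_zero, ← two_mul, mul_eq_zero] at h1
      exact hu0 (h1.resolve_left two_ne_zero)
    · have h1 : (⟨u, huint⟩ : 𝓞 M) ∈ P := mem_of_ramified he (hb2.trans hnM) hc hnt
        (by rw [hu, hb2]) hτu hτb hbint hram rfl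
      have h2 : (⟨v, hvint⟩ : 𝓞 M) ∈ P := by
        refine mem_of_ramified (c := -c) (e := -e) (t := -t) (m := m + t) (n := n) ?_
          (hb2.trans hnM) (by rw [hc]; ring) (by rw [hnt]; ring) (by rw [hv2, hb2]; push_cast; ring)
          hτv hτb hbint hram rfl
        rcases he with rfl | rfl <;> simp
      have hpP : (p : 𝓞 M) ∈ P := by
        have h3 : (p : 𝓞 M) = ⟨u, huint⟩ ^ 2 + ⟨v, hvint⟩ ^ 2 := RingOfIntegers.ext (by
          refine (map_natCast (algebraMap (𝓞 M) M) p).trans ?_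
          exact huv2.symm)
        rw [h3]
        exact P.add_mem (P.pow_mem_of_mem h1 2 two_pos) (P.pow_mem_of_mem h2 2 two_pos)
      have hbP : (⟨b, hb1⟩ : 𝓞 M) ∈ P := by
        refine hP.mem_of_pow_mem 2 ?_
        convert hpP using 1
        exact RingOfIntegers.ext (hb2.trans (map_natCast (algebraMap (𝓞 M) M) p).symm)
      have hone : ∀ j : ℤ, IsCoprime j p → (j : 𝓞 M) ∈ P → False := by
        rintro j ⟨x, y, hxy⟩ hj
        apply hP.ne_top
        rw [Ideal.eq_top_iff_one]
        have h3 : (1 : 𝓞 M) = x * j + y * p := by exact_mod_cast hxy.symm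
        rw [h3]
        exact P.add_mem (P.mul_mem_left _ hj) (P.mul_mem_left _ hpP)
      have hwP : (⟨_, hwint⟩ : 𝓞 M) ∈ P := by
        have h3 := hram ⟨_, hwint⟩
        have h4 : intConj τ ⟨_, hwint⟩ - ⟨_, hwint⟩ = -(2 * ⟨_, hwint⟩) := RingOfIntegers.ext (by
          change τ (u / algebraMap K M α) - u / algebraMap K M α = -(2 * (u / algebraMap K M α))
          rw [map_div₀, AlgEquiv.commutes, hτu]
          ring)
        rw [h4, neg_mem_iff] at h3
        refine (hP.mem_or_mem h3).resolve_left fun h5 => hone 2 ⟨-4 * n, 1, ?_⟩ (by simpa using h5)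
        linear_combination hn
      refine hone c ?_ ?_
      · rw [Int.isCoprime_iff_gcd_eq_one, Int.gcd_comm, ← Int.isCoprime_iff_gcd_eq_one,
          (Nat.prime_iff_prime_int.mp hp).coprime_iff_not_dvd]
        rintro ⟨j, rfl⟩
        have h3 : 0 < d ^ 2 := by positivity
        have h4 : (p : ℤ) * (1 - p * j ^ 2) = 4 * d ^ 2 := by linear_combination hcd
        have h5 : (0 : ℤ) < p := by exact_mod_cast hp.pos
        have h6 : 0 < 1 - (p : ℤ) * j ^ 2 := by
          by_contra! h7
          nlinarith
        have h7 : j ^ 2 = 0 := by nlinarith [sq_nonneg j]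
        have h8 : j = 0 := by simpa using h7
        rw [h8, mul_zero] at hcodd
        exact absurd hcodd (by decide)
      · have h3 : (c : 𝓞 M) = 2 * ⟨_, hwint⟩ ^ 2 - ⟨b, hb1⟩ := RingOfIntegers.ext (by
          refine (map_intCast (algebraMap (𝓞 M) M) c).trans ?_
          change (c : M) = 2 * (u / algebraMap K M α) ^ 2 - b
          rw [div_pow, ← hb, eq_sub_iff_add_eq, ← mul_div_assoc, eq_div_iff hb0]
          linear_combination hb2 - hu)
        rw [h3]
        exact P.sub_mem (P.mul_mem_left _ (P.pow_mem_of_mem hwP 2 two_pos)) hbP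
  exact card_mod_four_eq_two hodd (pow_two_mul_classNumber hKM) (Nat.not_odd_iff_even.mp heven)
    fun _ _ hc hc' h1 h1' => eq_of_two_torsion_quartic hk hkK hp hp8 hβ hα hc hc' h1 h1'

end UnramifiedQuadratic

section GaussSum

lemma exists_pow_four_eq_neg_one {p : ℕ} [Fact p.Prime] (hp8 : p % 8 = 1) :
    ∃ x : (ZMod p)ˣ, x ^ 4 = -1 := by
  obtain ⟨g, hg⟩ := IsCyclic.exists_ofOrder_eq_natCard (α := (ZMod p)ˣ)
  have hp1 := (Fact.out : p.Prime).one_lt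
  rw [Nat.card_eq_fintype_card, ZMod.card_units] at hg
  obtain ⟨m, hm⟩ : ∃ m, p - 1 = m * 8 := ⟨(p - 1) / 8, by omega⟩
  refine ⟨g ^ m, ?_⟩
  have h1 : (g ^ m) ^ 8 = 1 := by rw [← pow_mul, ← hm, ← hg, pow_orderOf_eq_one]
  have h2 : (g ^ m) ^ 4 ≠ 1 := by
    rw [← pow_mul]
    exact pow_ne_one_of_lt_orderOf (by omega) (by omega)
  have h3 : (((g ^ m : (ZMod p)ˣ) : ZMod p) ^ 4) ^ 2 = 1 := by
    rw [← pow_mul, ← Units.val_pow_eq_pow_val, h1, Units.val_one]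
  rcases mul_self_eq_one_iff.mp ((sq _).symm.trans h3) with h | h
  · exact absurd (Units.ext (by simpa using h)) h2
  · exact Units.ext (by simpa using h)

lemma exists_rat_eq_of_pow_four_eq_one {x : ℂ} (hx : x ^ 4 = 1) :
    ∃ r : ℚ, (r : ℂ) = (x + x⁻¹) / 2 := by
  have h0 : x ≠ 0 := by rintro rfl; norm_num at hx
  have h : (x ^ 2 - 1) * (x ^ 2 + 1) = 0 := by linear_combination hx
  rcases mul_eq_zero.mp h with h | h
  · rcases mul_self_eq_one_iff.mp ((sq x).symm.trans (sub_eq_zero.mp h)) with rfl | rfl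
    · exact ⟨1, by norm_num⟩
    · exact ⟨-1, by norm_num⟩
  · refine ⟨0, ?_⟩
    field_simp
    rw [h]
    norm_num

/-- The real part of a quartic Gauss sum. -/
lemma exists_quartic_gaussSum {p : ℕ} [Fact p.Prime] (hp8 : p % 8 = 1) {ζ : ℂ}
    (hζ : IsPrimitiveRoot ζ p) :
    ∃ (u b : ℂ) (r : ZMod p → ℚ) (c d : ℤ), b ^ 2 = p ∧ (p : ℤ) = c ^ 2 + 4 * d ^ 2 ∧
      2 * u ^ 2 = p + c * b ∧ u = ∑ a, (r a : ℂ) * ζ ^ a.val ∧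
      ∀ (s : (ZMod p)ˣ) (a : ZMod p), r (s ^ 4 * a) = r a := by
  have hcard : 4 ∣ Fintype.card (ZMod p) - 1 := by
    rw [ZMod.card]
    omega
  have hI : IsPrimitiveRoot Complex.I 4 := Complex.isPrimitiveRoot_I
  obtain ⟨χ, hχ⟩ := MulChar.exists_mulChar_orderOf (ZMod p) hcard hI
  have hχ4 : χ ^ 4 = 1 := hχ ▸ pow_orderOf_eq_one χ
  have hχ2 : χ ^ 2 ≠ 1 := pow_ne_one_of_lt_orderOf (by norm_num) (by omega)
  have hχ1 : χ ≠ 1 := by rintro rfl; simp at hχ2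
  set ψ := AddChar.zmodChar p hζ.pow_eq_one with hψdef
  have hψ : ψ.IsPrimitive := AddChar.zmodChar_primitive_of_primitive_root p hζ
  have happly (s : (ZMod p)ˣ) : χ s ^ 4 = 1 := by
    rw [← MulChar.pow_apply_coe, hχ4, MulChar.one_apply_coe]
  obtain ⟨x, hx⟩ := exists_pow_four_eq_neg_one hp8
  have hneg : χ (-1) = 1 := by
    have : (-1 : ZMod p) = (x : ZMod p) ^ 4 := by
      rw [← Units.val_pow_eq_pow_val, hx, Units.val_neg, Units.val_one]
    rw [this, map_pow, happly]
  have hinv : χ⁻¹ = χ ^ 3 := by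
    rw [inv_eq_iff_mul_eq_one, ← pow_succ', hχ4]
  have hinv2 : χ⁻¹ * χ⁻¹ = χ * χ := by
    rw [hinv, ← pow_add, ← pow_two]
    calc χ ^ 6 = χ ^ 4 * χ ^ 2 := by rw [← pow_add]
      _ = χ ^ 2 := by rw [hχ4, one_mul]
  have hquad : (χ * χ).IsQuadratic := by
    intro a
    by_cases ha : IsUnit a
    · right
      obtain ⟨s, rfl⟩ := ha
      rw [← mul_self_eq_one_iff, MulChar.mul_apply, ← happly s]
      ring
    · exact Or.inl (MulChar.map_nonunit _ ha)
  set A := gaussSum χ ψ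
  set B := gaussSum χ⁻¹ ψ
  set b := gaussSum (χ * χ) ψ
  have hAB : A * B = p := by
    have := gaussSum_mul_gaussSum_pow_orderOf_sub_one hχ1 hψ
    rwa [hχ, hneg, one_mul, ZMod.card, show 4 - 1 = 3 from rfl, ← hinv] at this
  have hb : b ^ 2 = p := by
    rw [gaussSum_sq (by rwa [← pow_two]) hquad hψ, ZMod.card, MulChar.mul_apply, hneg]
    simp
  have hA : b * jacobiSum χ χ = A * A := jacobiSum_mul_nontrivial (by rwa [← pow_two]) ψ
  have hB : b * jacobiSum χ⁻¹ χ⁻¹ = B * B := by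
    have := jacobiSum_mul_nontrivial (χ := χ⁻¹) (φ := χ⁻¹) (by rwa [hinv2, ← pow_two]) ψ
    rwa [hinv2] at this
  have hJ : jacobiSum χ χ * jacobiSum χ⁻¹ χ⁻¹ = p := by
    rw [jacobiSum_mul_jacobiSum_inv _ hχ1 hχ1 (by rwa [← pow_two]), ZMod.card]
    rw [ringChar.eq_zero, ZMod.ringChar_zmod_n]
    exact (Fact.out : p.Prime).ne_zero.symm
  have hstar : jacobiSum χ⁻¹ χ⁻¹ = starRingEnd ℂ (jacobiSum χ χ) := by
    simp only [jacobiSum, map_sum, map_mul, ← MulChar.star_apply', RCLike.star_def]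
  obtain ⟨z, hz, hJz⟩ := exists_jacobiSum_eq_neg_one_add (by norm_num : 2 < 4) hχ4 hχ4 hcard hI
  obtain ⟨m, n, rfl⟩ : ∃ m n : ℤ, z = m + n * Complex.I := by
    clear hJz
    induction hz using Algebra.adjoin_induction with
    | mem z hz => exact ⟨0, 1, by simpa using hz⟩
    | algebraMap r => exact ⟨r, 0, by simp⟩
    | add z w _ _ hz hw =>
      obtain ⟨m, n, rfl⟩ := hz
      obtain ⟨m', n', rfl⟩ := hw
      exact ⟨m + m', n + n', by push_cast; ring⟩
    | mul z w _ _ hz hw =>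
      obtain ⟨m, n, rfl⟩ := hz
      obtain ⟨m', n', rfl⟩ := hw
      refine ⟨m * m' - n * n', m * n' + n * m', ?_⟩
      push_cast
      linear_combination (n * n' : ℂ) * Complex.I_sq
  have hJ1 : jacobiSum χ χ = (-1 + 2 * n) - 2 * m * Complex.I := by
    rw [hJz]
    linear_combination (m + n * (Complex.I - 2) : ℂ) * Complex.I_sq
  have hJ2 : jacobiSum χ⁻¹ χ⁻¹ = (-1 + 2 * n) + 2 * m * Complex.I := by
    rw [hstar, hJ1]
    simp [Complex.conj_ofNat]
  have hr (a : ZMod p) : ∃ r : ℚ, (r : ℂ) = (χ a + χ⁻¹ a) / 2 := by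
    by_cases ha : IsUnit a
    · obtain ⟨s, rfl⟩ := ha
      obtain ⟨r, hr⟩ := exists_rat_eq_of_pow_four_eq_one (happly s)
      refine ⟨r, ?_⟩
      rw [hr, MulChar.inv_apply_eq_inv']
    · exact ⟨0, by rw [MulChar.map_nonunit _ ha, MulChar.map_nonunit _ ha]; simp⟩
  choose r hr using hr
  refine ⟨(A + B) / 2, b, r, -1 + 2 * n, m, hb, ?_, ?_, ?_, fun s a => ?_⟩
  · rw [hJ1, hJ2] at hJ
    have : (p : ℂ) = (-1 + 2 * n) ^ 2 + 4 * m ^ 2 := by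
      linear_combination -hJ - 4 * m ^ 2 * Complex.I_sq
    exact_mod_cast this
  · push_cast
    rw [hJ1] at hA
    rw [hJ2] at hB
    linear_combination hAB - hA / 2 - hB / 2
  · simp only [A, B, gaussSum, ← Finset.sum_add_distrib, Finset.sum_div, hr]
    refine Finset.sum_congr rfl fun a _ => ?_
    rw [hψdef, AddChar.zmodChar_apply]
    ring
  · have h3 : χ ((s : ZMod p) ^ 4 * a) = χ a := by rw [map_mul, map_pow, happly, one_mul]
    have h4 : χ⁻¹ ((s : ZMod p) ^ 4 * a) = χ⁻¹ a := by
      rw [MulChar.inv_apply_eq_inv', h3, MulChar.inv_apply_eq_inv']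
    have := hr (s ^ 4 * a)
    rw [h3, h4, ← hr a] at this
    exact_mod_cast this

end GaussSum

section QuarticSubfield

lemma exists_pow_eq_of_pow_eq_one {G : Type*} [Group G] [IsCyclic G] {m n : ℕ} (hm : m ≠ 0)
    (hG : Nat.card G = m * n) {t : G} (ht : t ^ m = 1) : ∃ s : G, s ^ n = t := by
  obtain ⟨g, hg⟩ := IsCyclic.exists_generator (α := G)
  obtain ⟨j, rfl⟩ := Subgroup.mem_zpowers_iff.mp (hg t)
  rw [← zpow_natCast, ← zpow_mul, ← orderOf_dvd_iff_zpow_eq_one,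
    orderOf_eq_card_of_forall_mem_zpowers hg, hG, mul_comm j, Nat.cast_mul,
    mul_dvd_mul_iff_left (by exact_mod_cast hm)] at ht
  obtain ⟨i, rfl⟩ := ht
  exact ⟨g ^ i, by rw [← zpow_natCast, ← zpow_mul, mul_comm]⟩

/-- Galois descent of cyclotomic sums to the subfields of the cyclotomic field. -/
lemma sum_mem_of_finrank_eq {p : ℕ} [Fact p.Prime] {n : ℕ} {K L : Type*} [Field K] [Field L]
    [Algebra K L] (hirr : Irreducible (Polynomial.cyclotomic p K)) [NeZero (p : K)]
    {ζ : L} (hζ : IsPrimitiveRoot ζ p) {F : IntermediateField K L} (hFle : F ≤ K⟮ζ⟯) (hF : Module.finrank K F = n)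
    {r : ZMod p → K} (hr : ∀ (s : (ZMod p)ˣ) (a : ZMod p), r (s ^ n * a) = r a) :
    ∑ a, algebraMap K L (r a) * ζ ^ a.val ∈ F := by
  have : IsCyclotomicExtension {p} K K⟮ζ⟯ := by
    change IsCyclotomicExtension {p} K K⟮ζ⟯.toSubalgebra
    rw [IntermediateField.adjoin_simple_toSubalgebra_of_isAlgebraic
      (hζ.isIntegral (Fact.out : p.Prime).pos).tower_top.isAlgebraic]
    exact hζ.adjoin_isCyclotomicExtension K
  have : IsGalois K K⟮ζ⟯ := IsCyclotomicExtension.isGalois {p} K K⟮ζ⟯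
  have : FiniteDimensional K K⟮ζ⟯ := IsCyclotomicExtension.finiteDimensional {p} K K⟮ζ⟯
  set z : K⟮ζ⟯ := AdjoinSimple.gen K ζ with hzdef
  have hz : IsPrimitiveRoot z p := by
    refine IsPrimitiveRoot.of_map_of_injective (f := K⟮ζ⟯.val) ?_ K⟮ζ⟯.val.injective
    exact hζ
  have hu : (∑ a, algebraMap K K⟮ζ⟯ (r a) * z ^ a.val : K⟮ζ⟯) ∈ IntermediateField.restrict hFle := by
    rw [← IsGalois.fixedField_fixingSubgroup (IntermediateField.restrict hFle),
      IntermediateField.mem_fixedField_iff]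
    intro σ hσ
    obtain ⟨s, hs⟩ : ∃ s, s ^ n = hz.autToPow K σ := by
      have hF' : Module.finrank K (IntermediateField.restrict hFle) = n :=
        ((IntermediateField.restrictAlgEquiv hFle).toLinearEquiv.finrank_eq).symm.trans hF
      have h1 := IsGalois.card_fixingSubgroup_eq_finrank (IntermediateField.restrict hFle)
      have h2 := Module.finrank_mul_finrank K (IntermediateField.restrict hFle) K⟮ζ⟯
      rw [IsCyclotomicExtension.finrank (n := p) K⟮ζ⟯ hirr, hF', mul_comm] at h2
      refine exists_pow_eq_of_pow_eq_one (m := Nat.card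
        (IntermediateField.restrict hFle).fixingSubgroup) Nat.card_pos.ne' ?_ ?_
      · rw [Nat.card_eq_fintype_card, ZMod.card_units_eq_totient, h1, h2]
      · rw [← map_pow]
        have := congrArg Subtype.val (pow_card_eq_one' (x := (⟨σ, hσ⟩ :
          (IntermediateField.restrict hFle).fixingSubgroup)))
        rw [Subgroup.coe_pow, Subgroup.coe_one] at this
        rw [this, map_one]
    have hσz (a : ZMod p) : σ (z ^ a.val) = z ^ (((hz.autToPow K σ : ZMod p) * a).val) := by
      rw [map_pow, ← hz.autToPow_spec K σ, ← pow_mul, ZMod.val_mul,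
        pow_eq_pow_mod _ hz.pow_eq_one]
    rw [map_sum]
    refine Fintype.sum_equiv (Units.mulLeft (hz.autToPow K σ)) _ _ fun a => ?_
    rw [map_mul, AlgEquiv.commutes, hσz, Units.mulLeft_apply, ← hs, Units.val_pow_eq_pow_val, hr]
  rw [IntermediateField.mem_restrict] at hu
  convert hu
  simp [hzdef]

lemma adjoin_eq_of_mem {p : ℕ} (hp : p.Prime) {F : IntermediateField ℚ ℂ}
    (hF : Module.finrank ℚ F = 4) {u : ℂ} (huF : u ∈ F) {d : ℤ} (hd : ¬ (p : ℤ) ∣ d)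
    (hu : u ^ 4 - p * u ^ 2 + d ^ 2 * p = 0) : ℚ⟮u⟯ = F := by
  have hpp : Prime (p : ℤ) := Nat.prime_iff_prime_int.mp hp
  set f : Polynomial ℤ := Polynomial.X ^ 4 - Polynomial.C (p : ℤ) * Polynomial.X ^ 2 +
    Polynomial.C (d ^ 2 * p) with hfdef
  have hdeg : f.natDegree = 4 := by
    rw [hfdef]
    compute_degree!
  have hmonic : f.Monic := by
    rw [hfdef]
    monicity!
  have hirr := irreducible_map_of_eisenstein hp hmonic (by omega) (fun n hn => by
      rw [hdeg] at hn
      rw [hfdef]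
      interval_cases n <;> simp [Polynomial.coeff_X_pow])
    (fun h => by
      have h1 : (p : ℤ) * p ∣ d ^ 2 * p := by simpa [hfdef, Polynomial.coeff_X_pow, sq] using h
      rw [mul_dvd_mul_iff_right hpp.ne_zero] at h1
      exact hd (hpp.dvd_of_dvd_pow h1))
  have haev : Polynomial.aeval u (f.map (algebraMap ℤ ℚ)) = 0 := by
    rw [Polynomial.aeval_map_algebraMap, hfdef]
    simpa using hu
  have hmin := minpoly.eq_of_irreducible_of_monic hirr haev (hmonic.map _)
  have : FiniteDimensional ℚ F := Module.finite_of_finrank_pos (by omega)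
  refine IntermediateField.eq_of_le_of_finrank_eq (adjoin_simple_le_iff.mpr huF) ?_
  rw [hF, IntermediateField.adjoin.finrank ⟨f.map (algebraMap ℤ ℚ), hmonic.map _, haev⟩, ← hmin,
    hmonic.natDegree_map, hdeg]

end QuarticSubfield

section Compositum

lemma finrank_adjoin_of_sq_eq_prime {K : Type*} [Field K] [NumberField K] {p : ℕ} (hp : p.Prime)
    {b : K} (hb : b ^ 2 = p) : Module.finrank ℚ ℚ⟮b⟯ = 2 := by
  have hirr : Irreducible (Polynomial.X ^ 2 - Polynomial.C (p : ℚ)) :=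
    X_pow_sub_C_irreducible_of_prime Nat.prime_two fun y => rat_sq_ne_prime hp y
  have hmin := minpoly.eq_of_irreducible_of_monic (x := b) hirr (by simp [hb])
    (Polynomial.monic_X_pow_sub_C _ (by norm_num))
  have h := IntermediateField.adjoin.finrank (Algebra.IsIntegral.isIntegral (R := ℚ) b)
  rw [← hmin, Polynomial.natDegree_X_pow_sub_C] at h
  convert h

lemma finrank_adjoin_of_sq_eq {L C : Type*} [Field L] [Field C] [Algebra L C] {u : C} {y : L}
    (hu : u ^ 2 = algebraMap L C y) (hne : ∀ x, algebraMap L C x ≠ u) :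
    Module.finrank L L⟮u⟯ = 2 := by
  have hirr : Irreducible (Polynomial.X ^ 2 - Polynomial.C y) := by
    refine X_pow_sub_C_irreducible_of_prime Nat.prime_two fun x hx => ?_
    rw [← hx, map_pow, sq_eq_sq_iff_eq_or_eq_neg] at hu
    rcases hu with hu | hu
    · exact hne x hu.symm
    · exact hne (-x) (by rw [map_neg, hu])
  have hmonic := Polynomial.monic_X_pow_sub_C y two_ne_zero
  have haev : Polynomial.aeval u (Polynomial.X ^ 2 - Polynomial.C y) = 0 := by simp [hu]
  rw [IntermediateField.adjoin.finrank ⟨_, hmonic, haev⟩,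
    ← minpoly.eq_of_irreducible_of_monic hirr haev hmonic, Polynomial.natDegree_X_pow_sub_C]

lemma adjoin_adjoin_simple {L : IntermediateField ℚ ℂ} (u : ℂ) :
    IntermediateField.adjoin L (ℚ⟮u⟯ : Set ℂ) = L⟮u⟯ := by
  refine le_antisymm (IntermediateField.adjoin_le_iff.mpr ?_)
    (IntermediateField.adjoin.mono _ _ _ ?_)
  · have h : ℚ⟮u⟯ ≤ (L⟮u⟯).restrictScalars ℚ :=
      IntermediateField.adjoin_simple_le_iff.mpr (IntermediateField.mem_adjoin_simple_self L u)
    exact h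
  · exact Set.singleton_subset_iff.mpr (IntermediateField.mem_adjoin_simple_self ℚ u)

end Compositum

/-- **Corollary 2.**  Let `p` be a prime with `p ≡ 1 (mod 8)`, let `F` be the quartic subfield
of the cyclotomic field `ℚ(μ_p)` (inside `ℂ`), and let `L = ℚ(p^{1/4})` (inside `ℂ`).  If the
compositum `M = F·L = F(p^{1/4})` has odd class number, then the class number of `L` is
`≡ 2 (mod 4)`. -/
theorem classNumber_mod_four_eq_two_of_compositum_classNumber_odd
    (p : ℕ) (hp : p.Prime) (hp8 : p % 8 = 1)
    (ζ : ℂ) (hζ : IsPrimitiveRoot ζ p)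
    (F : IntermediateField ℚ ℂ) (hFle : F ≤ ℚ⟮ζ⟯) (hF4 : Module.finrank ℚ F = 4)
    (α : ℂ) (hα : α ^ 4 = (p : ℂ))
    (L : IntermediateField ℚ ℂ) (hL : L = ℚ⟮α⟯) [NumberField L]
    (M : IntermediateField L ℂ) (hM : M = IntermediateField.adjoin L (F : Set ℂ))
    [NumberField M]
    (hodd : Odd (NumberField.classNumber M)) :
    NumberField.classNumber L % 4 = 2 := by
  have : Fact p.Prime := ⟨hp⟩
  obtain ⟨u, b, r, c, d, hb, hcd, hu, hur, hr⟩ := exists_quartic_gaussSum hp8 hζ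
  have hbα : b = α ^ 2 ∨ b = -α ^ 2 := by
    rw [← sq_eq_sq_iff_eq_or_eq_neg, hb, ← hα]
    ring
  wlog hbp : b = α ^ 2 generalizing b c
  · refine this (-b) (-c) (by rw [neg_sq, hb]) (by rw [neg_sq, hcd]) (by rw [hu]; push_cast; ring)
      ?_ ?_
    · rcases hbα with h | h
      · exact absurd h hbp
      · exact Or.inl (by rw [h, neg_neg])
    · rw [hbα.resolve_left hbp, neg_neg]
  subst hbp
  have hd : d ≠ 0 := by
    rintro rfl
    apply rat_sq_ne_prime hp c
    have : (p : ℚ) = c ^ 2 + 4 * 0 ^ 2 := by exact_mod_cast hcd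
    rw [this]
    ring
  have hpd : ¬ (p : ℤ) ∣ d := fun h => by
    have h1 := Int.natAbs_dvd_natAbs.mpr h
    have h2 : p ≤ d.natAbs := Nat.le_of_dvd (by omega) (by simpa using h1)
    have h3 : (p : ℤ) ^ 2 ≤ d ^ 2 := by
      rw [← Int.natAbs_sq d]
      gcongr
    nlinarith [hp.one_lt, sq_nonneg c]
  have huF : u ∈ F := by
    rw [hur]
    have : NeZero (p : ℚ) := ⟨by exact_mod_cast hp.ne_zero⟩
    exact sum_mem_of_finrank_eq (Polynomial.cyclotomic.irreducible_rat hp.pos) hζ hFle hF4 hr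
  have hFu : ℚ⟮u⟯ = F := by
    refine adjoin_eq_of_mem hp hF4 huF hpd ?_
    have : (p : ℂ) = c ^ 2 + 4 * d ^ 2 := by exact_mod_cast hcd
    linear_combination (2 * u ^ 2 - p + c * α ^ 2) / 4 * hu + c ^ 2 / 4 * hα - p / 4 * this
  have hαL : α ∈ L := hL ▸ IntermediateField.mem_adjoin_simple_self ℚ α
  set a : L := ⟨α, hαL⟩ with ha
  have ha4 : a ^ 4 = p := Subtype.ext hα
  have hβ : (AdjoinSimple.gen ℚ (a ^ 2)) ^ 2 = (p : ℚ⟮a ^ 2⟯) := by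
    have h : (a ^ 2) ^ 2 = p := by rw [← ha4]; ring
    exact Subtype.ext h
  have hk := finrank_adjoin_of_sq_eq_prime hp (b := a ^ 2) (by rw [← ha4]; ring)
  have hL4 : Module.finrank ℚ L = 4 := by
    have hint : IsIntegral ℚ α := ⟨_, Polynomial.monic_X_pow_sub_C (p : ℚ) four_ne_zero, by
      simp [hα]⟩
    rw [hL, IntermediateField.adjoin.finrank hint, minpoly_of_pow_four_eq_prime hp hα,
      Polynomial.natDegree_X_pow_sub_C]
  have hkK : Module.finrank ℚ⟮a ^ 2⟯ L = 2 := by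
    have h := Module.finrank_mul_finrank ℚ ℚ⟮a ^ 2⟯ L
    rw [hk, hL4] at h
    omega
  have hM' : M = L⟮u⟯ := by rw [hM, ← hFu, adjoin_adjoin_simple]
  have hne := algebraMap_ne_of_sq_eq (M := ℂ) hk hkK hp hβ rfl hd hcd hu
  have huM : u ∈ M := hM' ▸ IntermediateField.mem_adjoin_simple_self L u
  have hKM : Module.finrank L M = 2 := by
    rw [hM']
    refine finrank_adjoin_of_sq_eq (y := (p + c * a ^ 2) / 2) ?_ hne
    simp only [map_div₀, map_add, map_natCast, map_mul, map_intCast, map_pow, map_ofNat]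
    rw [eq_div_iff two_ne_zero, mul_comm]
    exact hu
  refine classNumber_quartic_mod_four hk hkK hKM hp hp8 hβ rfl hcd (u := ⟨u, huM⟩) ?_ hodd
  exact Subtype.ext hu
end
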